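/- Let (q,r,α) be an admissible triple. Then there exists a constant C > 0 such that for every Schwartz function u₀ on ℝ, ‖D^{(α/2)(1−2/r)} e^{it∂_x⁴} u₀‖_{L_t^q L_x^r(ℝ×ℝ)} ≤ C ‖u₀‖_{L²(ℝ)}. -/

import Mathlib

open MeasureTheory Complex
open scoped ENNReal

/-- The Fourier transform `û(ξ) = ∫ e^{-ixξ} u(x) dx`. -/
noncomputable def fourierInt (u : ℝ → ℂ) (ξ : ℝ) : ℂ :=
  ∫ x : ℝ, Complex.exp (-(Complex.I * x * ξ)) * u x

/-- `(D^β e^{it∂_x⁴} u)(x) = (2π)⁻¹ ∫ |ξ|^β e^{i(xξ+tξ⁴)} û(ξ) dξ`. -/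
noncomputable def DbihamGroup (β t : ℝ) (u : ℝ → ℂ) (x : ℝ) : ℂ :=
  (2 * Real.pi)⁻¹ * ∫ ξ : ℝ, ((|ξ| ^ β : ℝ) : ℂ) *
    Complex.exp (Complex.I * (x * ξ + t * ξ^4)) * fourierInt u ξ

/-- `(q,r,α)` is an admissible triple: `α ∈ [0,1]`, `r ≥ 2`, `q ≥ 8/(1+α)` and
`4/q + (1+α)/r = (1+α)/2`. -/
def Admissible (q r : ℝ≥0∞) (α : ℝ) : Prop :=
  α ∈ Set.Icc (0:ℝ) 1 ∧ 2 ≤ r ∧ ENNReal.ofReal (8 / (1 + α)) ≤ q ∧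
    4 / q + ENNReal.ofReal (1 + α) / r = ENNReal.ofReal ((1 + α) / 2)

/-- The mixed space-time norm `‖F‖_{L_t^q L_x^r}` (with the usual modification
when `q = ∞` or `r = ∞`). -/
noncomputable def mixedNorm (q r : ℝ≥0∞) (F : ℝ → ℝ → ℂ) : ℝ≥0∞ :=
  eLpNorm (fun t => (eLpNorm (F t) r volume).toReal) q volume

lemma norm_integral_mul_exp_le {a b : ℝ} (hab : a ≤ b) {φ φ' g g' G G' : ℝ → ℝ}
    (hφ : ∀ x ∈ Set.Icc a b, HasDerivAt φ (φ' x) x)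
    (hg : ∀ x ∈ Set.Icc a b, HasDerivAt g (g' x) x)
    (hG : ∀ x ∈ Set.Icc a b, HasDerivAt G (G' x) x)
    (hφc : ContinuousOn φ' (Set.Icc a b)) (hgc : ContinuousOn g' (Set.Icc a b))
    (hGc : ContinuousOn G' (Set.Icc a b))
    (hle : ∀ x ∈ Set.Icc a b, |g' x| ≤ G' x) :
    ‖∫ x in a..b, ((g x * φ' x : ℝ) : ℂ) * cexp (I * φ x)‖ ≤ |g a| + |g b| + (G b - G a) := by
  have hφcont : ContinuousOn φ (Set.Icc a b) := fun x hx => (hφ x hx).continuousAt.continuousWithinAt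
  have hexp : ContinuousOn (fun x => cexp (I * φ x)) (Set.Icc a b) := by fun_prop
  have hib := intervalIntegral.integral_mul_deriv_eq_deriv_mul (a := a) (b := b)
    (u := fun x => (g x : ℂ)) (v := fun x => -I * cexp (I * φ x))
    (u' := fun x => (g' x : ℂ)) (v' := fun x => φ' x * cexp (I * φ x))
    (fun x hx => (hg x (by rwa [Set.uIcc_of_le hab] at hx)).ofReal_comp)
    (fun x hx => by
      have h1 := (hφ x (by rwa [Set.uIcc_of_le hab] at hx)).ofReal_comp
      have h2 := ((h1.const_mul I).cexp).const_mul (-I)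
      convert h2 using 1
      linear_combination (cexp (I * φ x) * φ' x) * I_mul_I)
    (by
      apply ContinuousOn.intervalIntegrable
      rw [Set.uIcc_of_le hab]
      fun_prop)
    (by
      apply ContinuousOn.intervalIntegrable
      rw [Set.uIcc_of_le hab]
      fun_prop)
  have hcongr : ∫ x in a..b, ((g x * φ' x : ℝ) : ℂ) * cexp (I * φ x)
      = ∫ x in a..b, (g x : ℂ) * (φ' x * cexp (I * φ x)) := by
    congr 1; ext x; push_cast; ring
  have hn : ∀ x : ℝ, ‖-I * cexp (I * φ x)‖ = 1 := fun x => by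
    rw [norm_mul, mul_comm I, norm_exp_ofReal_mul_I]; simp
  have hint : ‖∫ x in a..b, (g' x : ℂ) * (-I * cexp (I * φ x))‖ ≤ G b - G a := by
    have hFT : ∫ x in a..b, G' x = G b - G a :=
      intervalIntegral.integral_eq_sub_of_hasDerivAt
        (fun x hx => hG x (by rwa [Set.uIcc_of_le hab] at hx))
        (ContinuousOn.intervalIntegrable (by rwa [Set.uIcc_of_le hab]))
    rw [← hFT]
    refine intervalIntegral.norm_integral_le_of_norm_le hab ?_
      (ContinuousOn.intervalIntegrable (by rwa [Set.uIcc_of_le hab]))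
    refine Filter.Eventually.of_forall fun x hx => ?_
    rw [norm_mul, hn, mul_one, norm_real]
    exact hle x (Set.Ioc_subset_Icc_self hx)
  rw [hcongr, hib]
  refine (norm_sub_le _ _).trans (add_le_add ((norm_sub_le _ _).trans ?_) hint)
  rw [norm_mul (g b : ℂ), norm_mul (g a : ℂ), hn, hn, norm_real, norm_real, Real.norm_eq_abs,
    Real.norm_eq_abs]
  linarith

/-- Derivative of the amplitude quotient. -/
lemma hasDerivAt_rpow_div_cubic (α y : ℝ) {x : ℝ} (hx : 0 < x) (h : y + 4 * x ^ 3 ≠ 0) :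
    HasDerivAt (fun x : ℝ => x ^ α / (y + 4 * x ^ 3))
      (x ^ (α - 1) * (α * y - (12 - 4 * α) * x ^ 3) / (y + 4 * x ^ 3) ^ 2) x := by
  have h1 := Real.hasDerivAt_rpow_const (x := x) (p := α) (Or.inl hx.ne')
  have h2 : HasDerivAt (fun x : ℝ => y + 4 * x ^ 3) (12 * x ^ 2) x := by
    refine (((hasDerivAt_pow 3 x).const_mul 4).const_add y).congr_deriv ?_
    norm_num; ring
  refine (h1.fun_div h2 h).congr_deriv ?_
  congr 1
  have : x ^ α = x ^ (α - 1) * x := by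
    rw [← Real.rpow_add_one hx.ne']; congr 1; ring
  rw [this]; ring

lemma hasDerivAt_quartic (y x : ℝ) :
    HasDerivAt (fun x : ℝ => y * x + x ^ 4) (y + 4 * x ^ 3) x := by
  refine (((hasDerivAt_id' x).const_mul y).fun_add (hasDerivAt_pow 4 x)).congr_deriv ?_
  norm_num

lemma norm_integral_rpow_mul_exp_le_of_deriv {α y a b : ℝ} (ha : 1 ≤ a) (hab : a ≤ b)
    (hne : ∀ x ∈ Set.Icc a b, y + 4 * x ^ 3 ≠ 0) {G G' : ℝ → ℝ}
    (hG : ∀ x ∈ Set.Icc a b, HasDerivAt G (G' x) x) (hGc : ContinuousOn G' (Set.Icc a b))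
    (hle : ∀ x ∈ Set.Icc a b,
      |x ^ (α - 1) * (α * y - (12 - 4 * α) * x ^ 3) / (y + 4 * x ^ 3) ^ 2| ≤ G' x) :
    ‖∫ x in a..b, ((x ^ α : ℝ) : ℂ) * cexp (I * (y * x + x ^ 4))‖ ≤
      |a ^ α / (y + 4 * a ^ 3)| + |b ^ α / (y + 4 * b ^ 3)| + (G b - G a) := by
  have hpos : ∀ x ∈ Set.Icc a b, 0 < x := fun x hx => by linarith [hx.1]
  have hgc : ContinuousOn
      (fun x : ℝ => x ^ (α - 1) * (α * y - (12 - 4 * α) * x ^ 3) / (y + 4 * x ^ 3) ^ 2)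
      (Set.Icc a b) := by
    refine ContinuousOn.div (ContinuousOn.mul ?_ (by fun_prop)) (by fun_prop)
      (fun x hx => pow_ne_zero _ (hne x hx))
    exact fun x hx => (Real.continuousAt_rpow_const _ _ (Or.inl (hpos x hx).ne')).continuousWithinAt
  have := norm_integral_mul_exp_le hab (φ := fun x => y * x + x ^ 4)
    (φ' := fun x => y + 4 * x ^ 3) (fun x _ => hasDerivAt_quartic y x)
    (fun x hx => hasDerivAt_rpow_div_cubic α y (hpos x hx) (hne x hx)) hG (by fun_prop) hgc hGc hle
  refine le_trans (le_of_eq ?_) this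
  congr 1
  refine intervalIntegral.integral_congr fun x hx => ?_
  rw [Set.uIcc_of_le hab] at hx
  have hx' := hne x hx
  rw [div_mul_cancel₀ _ hx']
  push_cast; rfl

lemma norm_integral_rpow_mul_exp_le_of_nonneg {α y a b : ℝ} (h0 : 0 ≤ α) (h1 : α ≤ 1)
    (hy : 0 ≤ y) (ha : 1 ≤ a) (hab : a ≤ b) :
    ‖∫ x in a..b, ((x ^ α : ℝ) : ℂ) * cexp (I * (y * x + x ^ 4))‖ ≤ 2 := by
  have hg : ∀ x : ℝ, 1 ≤ x → |x ^ α / (y + 4 * x ^ 3)| ≤ 1 / 4 := fun x hx => by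
    have hx0 : 0 < x := by linarith
    have hxa : x ^ α ≤ x := by simpa using Real.rpow_le_rpow_of_exponent_le hx h1
    rw [abs_of_nonneg (by positivity), div_le_iff₀ (by positivity)]
    nlinarith [pow_le_pow_right₀ hx (show 1 ≤ 3 by norm_num)]
  have hG : ∀ x ∈ Set.Icc a b, HasDerivAt (fun x : ℝ => -(x ^ 2)⁻¹ / 2) (1 / x ^ 3) x := by
    intro x hx
    have hx0 : 0 < x := by linarith [hx.1]
    refine (((hasDerivAt_pow 2 x).fun_inv (by positivity)).fun_neg.div_const 2).congr_deriv ?_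
    field_simp
    norm_num
    ring
  refine (norm_integral_rpow_mul_exp_le_of_deriv ha hab (fun x hx => ?_) hG ?_ ?_).trans ?_
  · have : 0 < x := by linarith [hx.1]
    positivity
  · exact ContinuousOn.div (by fun_prop) (by fun_prop)
      (fun x hx => pow_ne_zero _ (by linarith [hx.1]))
  · intro x hx
    have hx1 : 1 ≤ x := ha.trans hx.1
    have hx0 : 0 < x := by linarith
    have hxa : x ^ (α - 1) ≤ 1 := Real.rpow_le_one_of_one_le_of_nonpos hx1 (by linarith)
    have hxa0 : 0 ≤ x ^ (α - 1) := by positivity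
    have hx3 : 0 < x ^ 3 := by positivity
    rw [abs_div, abs_mul, abs_of_nonneg hxa0, abs_of_nonneg (a := (y + 4 * x ^ 3) ^ 2) (by positivity),
      div_le_div_iff₀ (by positivity) hx3]
    have h2 : |α * y - (12 - 4 * α) * x ^ 3| ≤ y + 12 * x ^ 3 := by
      rw [abs_le]; constructor <;> nlinarith [mul_nonneg h0 hx3.le, mul_le_mul_of_nonneg_right h1 hy, mul_nonneg h0 hy]
    calc x ^ (α - 1) * |α * y - (12 - 4 * α) * x ^ 3| * x ^ 3
        ≤ 1 * (y + 12 * x ^ 3) * x ^ 3 := by gcongr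
      _ ≤ 1 * (y + 4 * x ^ 3) ^ 2 := by nlinarith [mul_nonneg hy hx3.le, sq_nonneg y, sq_nonneg (x^3)]
  · have := hg a ha
    have := hg b (ha.trans hab)
    have : (a ^ 2)⁻¹ ≤ 1 := inv_le_one_of_one_le₀ (one_le_pow₀ ha)
    have : 0 ≤ (b ^ 2)⁻¹ := by positivity
    linarith

lemma norm_integral_rpow_mul_exp_le_of_quotient_bound {α c a b : ℝ} (h0 : 0 ≤ α) (h1 : α ≤ 1)
    (hc : 0 ≤ c) (ha : 1 ≤ a) (hab : a ≤ b) (hne : ∀ x ∈ Set.Icc a b, x ≠ c)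
    (hg : ∀ x ∈ Set.Icc a b, |x ^ α / (-(4 * c ^ 3) + 4 * x ^ 3)| ≤ 1 / 2) :
    ‖∫ x in a..b, ((x ^ α : ℝ) : ℂ) * cexp (I * ((-(4 * c ^ 3) : ℝ) * x + x ^ 4))‖ ≤ 2 := by
  have hpos : ∀ x ∈ Set.Icc a b, 0 < x := fun x hx => by linarith [hx.1]
  have hne' : ∀ x ∈ Set.Icc a b, -(4 * c ^ 3) + 4 * x ^ 3 ≠ 0 := fun x hx h => by
    refine hne x hx ((pow_left_inj₀ (hpos x hx).le hc (three_ne_zero)).1 (by linarith))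
  have := norm_integral_rpow_mul_exp_le_of_deriv (α := α) ha hab hne'
    (fun x hx => (hasDerivAt_rpow_div_cubic α _ (hpos x hx) (hne' x hx)).neg) ?_ ?_
  · refine this.trans ?_
    have h3 := hg a ⟨le_rfl, hab⟩
    have h4 := hg b ⟨hab, le_rfl⟩
    have h5 := abs_le.1 h3
    have h6 := abs_le.1 h4
    simp only [Pi.neg_apply]
    linarith [h5.2, h6.1]
  · refine (ContinuousOn.div (ContinuousOn.mul ?_ (by fun_prop)) (by fun_prop)
      (fun x hx => pow_ne_zero _ (hne' x hx))).neg
    exact fun x hx => (Real.continuousAt_rpow_const _ _ (Or.inl (hpos x hx).ne')).continuousWithinAt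
  · intro x hx
    have hx0 := hpos x hx
    rw [abs_of_nonpos]
    apply div_nonpos_of_nonpos_of_nonneg _ (sq_nonneg _)
    apply mul_nonpos_of_nonneg_of_nonpos (by positivity)
    have : 0 < x ^ 3 := by positivity
    have : 0 ≤ α * c ^ 3 := by positivity
    nlinarith

lemma norm_integral_rpow_mul_exp_le_of_neg {α c R : ℝ} (h0 : 0 ≤ α) (h1 : α ≤ 1)
    (hc : 0 ≤ c) (hR : 1 ≤ R) :
    ‖∫ x in (1:ℝ)..R, ((x ^ α : ℝ) : ℂ) * cexp (I * ((-(4 * c ^ 3) : ℝ) * x + x ^ 4))‖ ≤ 6 := by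
  set δ : ℝ := 1 / (1 + c) with hδ
  have hδ0 : 0 < δ := by positivity
  have hδc : δ * (1 + c) = 1 := by rw [hδ]; field_simp
  have hδ1 : δ ≤ 1 := by nlinarith
  set F : ℝ → ℂ := fun x => ((x ^ α : ℝ) : ℂ) * cexp (I * ((-(4 * c ^ 3) : ℝ) * x + x ^ 4))
  set p : ℝ := max 1 (min R (c - δ)) with hp
  set q : ℝ := max 1 (min R (c + δ)) with hq
  have h1p : 1 ≤ p := le_max_left _ _
  have hpq : p ≤ q := max_le_max le_rfl (min_le_min le_rfl (by linarith))
  have hqR : q ≤ R := max_le hR (min_le_left _ _)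
  have hxa : ∀ x : ℝ, 1 ≤ x → x ^ α ≤ x := fun x hx => by
    simpa using Real.rpow_le_rpow_of_exponent_le hx h1
  have hint : ∀ u v : ℝ, IntervalIntegrable F volume u v := fun u v => by
    refine Continuous.intervalIntegrable ?_ u v
    have : Continuous fun x : ℝ => x ^ α := Real.continuous_rpow_const h0
    fun_prop
  have e1 : ‖∫ x in (1:ℝ)..p, F x‖ ≤ 2 := by
    rcases le_total (min R (c - δ)) 1 with h | h
    · have : p = 1 := max_eq_left h
      rw [this]; simp
    · have hpe : p = min R (c - δ) := max_eq_right h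
      have hpc : p ≤ c - δ := hpe ▸ min_le_right _ _
      refine norm_integral_rpow_mul_exp_le_of_quotient_bound h0 h1 hc le_rfl h1p
        (fun x hx => by linarith [hx.2]) (fun x hx => ?_)
      have hxc : x ≤ c - δ := hx.2.trans hpc
      have hx1 := hx.1
      have hc1 : 1 ≤ c := by linarith
      have key : δ * c ^ 2 ≤ c ^ 3 - x ^ 3 := by
        have : c ^ 3 - x ^ 3 = (c - x) * (c ^ 2 + c * x + x ^ 2) := by ring
        rw [this]
        exact mul_le_mul (by linarith) (by nlinarith) (by positivity) (by linarith)
      have hk0 : 0 < δ * c ^ 2 := by positivity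
      rw [abs_div, abs_of_nonneg (by positivity : 0 ≤ x ^ α), abs_of_neg (by linarith),
        div_le_iff₀ (by linarith)]
      have := hxa x hx1
      nlinarith
  have e2 : ‖∫ x in p..q, F x‖ ≤ 2 := by
    have hlen : q - p ≤ 2 * δ := by
      have h1 : q ≤ max 1 (min R (c - δ) + 2 * δ) := by
        refine max_le_max le_rfl ?_
        rw [← min_add_add_right]
        exact min_le_min (by linarith) (by linarith)
      have h2 : max 1 (min R (c - δ) + 2 * δ) ≤ p + 2 * δ :=
        max_le (by linarith) (by linarith [le_max_right 1 (min R (c - δ))])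
      linarith
    rcases eq_or_lt_of_le hpq with h | h
    · rw [h]; simp
    have hqc : q ≤ c + δ := by
      rcases le_total (min R (c + δ)) 1 with h' | h'
      · have : q = 1 := max_eq_left h'
        linarith
      · exact (max_eq_right h').le.trans (min_le_right _ _)
    have := intervalIntegral.norm_integral_le_of_norm_le_const (a := p) (b := q) (f := F)
      (C := c + 1) (fun x hx => by
        rw [Set.uIoc_of_le hpq] at hx
        have hx1 : 1 ≤ x := by linarith [hx.1]
        have : ‖cexp (I * ((-(4 * c ^ 3) : ℝ) * x + x ^ 4))‖ = 1 := by
          have := norm_exp_ofReal_mul_I (-(4 * c ^ 3) * x + x ^ 4)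
          rw [← this]; push_cast; ring_nf
        simp only [F]
        rw [norm_mul, this, mul_one, norm_real, Real.norm_eq_abs, abs_of_nonneg (by positivity)]
        linarith [hxa x hx1, hx.2])
    refine this.trans ?_
    rw [abs_of_nonneg (by linarith)]
    calc (c + 1) * (q - p) ≤ (c + 1) * (2 * δ) := by gcongr
      _ = 2 := by linear_combination 2 * hδc
  have e3 : ‖∫ x in q..R, F x‖ ≤ 2 := by
    rcases le_total R (c + δ) with h | h
    · have : q = R := by rw [hq, min_eq_left h, max_eq_right hR]
      rw [this]; simp
    · have hqc : c + δ ≤ q := by rw [hq, min_eq_right h]; exact le_max_right _ _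
      refine norm_integral_rpow_mul_exp_le_of_quotient_bound h0 h1 hc (h1p.trans hpq) hqR
        (fun x hx => by linarith [hx.1]) (fun x hx => ?_)
      have hxc : c + δ ≤ x := hqc.trans hx.1
      have hx1 : 1 ≤ x := by linarith [hx.1]
      have key : δ * x ^ 2 ≤ x ^ 3 - c ^ 3 := by
        have : x ^ 3 - c ^ 3 = (x - c) * (x ^ 2 + x * c + c ^ 2) := by ring
        rw [this]
        exact mul_le_mul (by linarith) (by nlinarith) (by positivity) (by linarith)
      have hk0 : 0 < δ * x ^ 2 := by positivity
      rw [abs_div, abs_of_nonneg (by positivity : 0 ≤ x ^ α), abs_of_pos (by linarith),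
        div_le_iff₀ (by linarith)]
      have := hxa x hx1
      have : 1 ≤ δ * (2 * x) := by nlinarith
      nlinarith
  have hsum : ∫ x in (1:ℝ)..R, F x
      = (∫ x in (1:ℝ)..p, F x) + (∫ x in p..q, F x) + ∫ x in q..R, F x := by
    rw [intervalIntegral.integral_add_adjacent_intervals (hint _ _) (hint _ _),
      intervalIntegral.integral_add_adjacent_intervals (hint _ _) (hint _ _)]
  rw [hsum]
  refine (norm_add₃_le).trans ?_
  linarith

lemma norm_integral_rpow_mul_exp_le {α y R : ℝ} (h0 : 0 ≤ α) (h1 : α ≤ 1) (hR : 0 ≤ R) :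
    ‖∫ x in (0:ℝ)..R, ((x ^ α : ℝ) : ℂ) * cexp (I * (y * x + x ^ 4))‖ ≤ 7 := by
  have hint : ∀ u v : ℝ, IntervalIntegrable
      (fun x : ℝ => ((x ^ α : ℝ) : ℂ) * cexp (I * (y * x + x ^ 4))) volume u v := fun u v => by
    refine Continuous.intervalIntegrable ?_ u v
    have : Continuous fun x : ℝ => x ^ α := Real.continuous_rpow_const h0
    fun_prop
  have triv : ∀ r : ℝ, 0 ≤ r → r ≤ 1 →
      ‖∫ x in (0:ℝ)..r, ((x ^ α : ℝ) : ℂ) * cexp (I * (y * x + x ^ 4))‖ ≤ 1 := fun r hr0 hr1 => by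
    have := intervalIntegral.norm_integral_le_of_norm_le_const (a := 0) (b := r)
      (f := fun x : ℝ => ((x ^ α : ℝ) : ℂ) * cexp (I * (y * x + x ^ 4)))
      (C := 1) (fun x hx => by
        rw [Set.uIoc_of_le hr0] at hx
        have : ‖cexp (I * (y * x + x ^ 4))‖ = 1 := by
          have := norm_exp_ofReal_mul_I (y * x + x ^ 4)
          rw [← this]; push_cast; ring_nf
        rw [norm_mul, this, mul_one, norm_real, Real.norm_eq_abs,
          abs_of_nonneg (Real.rpow_nonneg hx.1.le _)]
        exact Real.rpow_le_one hx.1.le (hx.2.trans hr1) h0)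
    refine this.trans ?_
    rw [sub_zero, one_mul, abs_of_nonneg hr0]; exact hr1
  rcases le_total R 1 with h | h
  · linarith [triv R hR h]
  rw [← intervalIntegral.integral_add_adjacent_intervals (hint 0 1) (hint 1 R)]
  refine (norm_add_le _ _).trans ?_
  have h2 : ‖∫ x in (1:ℝ)..R, ((x ^ α : ℝ) : ℂ) * cexp (I * (y * x + x ^ 4))‖ ≤ 6 := by
    rcases le_total 0 y with hy | hy
    · linarith [norm_integral_rpow_mul_exp_le_of_nonneg h0 h1 hy le_rfl h]
    · set c : ℝ := (-y / 4) ^ (1 / 3 : ℝ)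
      have hc3 : c ^ 3 = -y / 4 := by
        rw [← Real.rpow_natCast, ← Real.rpow_mul (by linarith)]; norm_num
      have := norm_integral_rpow_mul_exp_le_of_neg h0 h1 (c := c)
        (Real.rpow_nonneg (by linarith) _) h
      rwa [hc3, show -(4 * (-y / 4)) = y by ring] at this
  linarith [triv 1 zero_le_one le_rfl]

lemma norm_integral_half_le {α t : ℝ} (h0 : 0 ≤ α) (h1 : α ≤ 1) (ht : 0 < t) (x : ℝ) {R : ℝ}
    (hR : 0 ≤ R) :
    ‖∫ ξ in (0:ℝ)..R, ((|ξ| ^ α : ℝ) : ℂ) * cexp (I * (x * ξ + t * ξ ^ 4))‖ ≤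
      7 * t ^ (-((1 + α) / 4)) := by
  set l : ℝ := t ^ (1 / 4 : ℝ) with hl
  have hl0 : 0 < l := Real.rpow_pos_of_pos ht _
  have hl4 : l ^ 4 = t := by
    rw [hl, ← Real.rpow_natCast, ← Real.rpow_mul ht.le]; norm_num
  have hlα : l⁻¹ * l ^ (-α) = t ^ (-((1 + α) / 4)) := by
    rw [← Real.rpow_neg_one, ← Real.rpow_add hl0, hl, ← Real.rpow_mul ht.le]; congr 1; ring
  have hcongr : ∫ ξ in (0:ℝ)..R, ((|ξ| ^ α : ℝ) : ℂ) * cexp (I * (x * ξ + t * ξ ^ 4))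
      = ∫ ξ in (0:ℝ)..R, ((l ^ (-α) : ℝ) : ℂ) *
        ((fun η : ℝ => ((η ^ α : ℝ) : ℂ) * cexp (I * ((x / l : ℝ) * η + η ^ 4))) (l * ξ)) := by
    refine intervalIntegral.integral_congr fun ξ hξ => ?_
    rw [Set.uIcc_of_le hR] at hξ
    have e1 : |ξ| ^ α = l ^ (-α) * (l * ξ) ^ α := by
      rw [abs_of_nonneg hξ.1, Real.mul_rpow hl0.le hξ.1, ← mul_assoc, ← Real.rpow_add hl0]
      simp
    have e2 : (x * ξ + t * ξ ^ 4 : ℂ) = (x / l : ℝ) * (l * ξ : ℝ) + (l * ξ : ℝ) ^ 4 := by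
      have h2 : (l : ℂ) ≠ 0 := by exact_mod_cast hl0.ne'
      rw [← hl4]; push_cast; field_simp
    dsimp only
    rw [e1, e2]; push_cast; ring
  rw [hcongr, intervalIntegral.integral_const_mul,
    intervalIntegral.integral_comp_mul_left
      (fun η : ℝ => ((η ^ α : ℝ) : ℂ) * cexp (I * ((x / l : ℝ) * η + η ^ 4))) hl0.ne', norm_mul, norm_smul, norm_real, norm_inv,
    Real.norm_of_nonneg hl0.le, Real.norm_of_nonneg (Real.rpow_nonneg hl0.le _), mul_zero]
  calc l ^ (-α) * (l⁻¹ * _) ≤ l ^ (-α) * (l⁻¹ * 7) := by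
        gcongr
        exact norm_integral_rpow_mul_exp_le h0 h1 (by positivity)
    _ = _ := by rw [← hlα]; ring

lemma norm_integral_half_le' {α t : ℝ} (h0 : 0 ≤ α) (h1 : α ≤ 1) (ht : t ≠ 0) (x : ℝ) {R : ℝ}
    (hR : 0 ≤ R) :
    ‖∫ ξ in (0:ℝ)..R, ((|ξ| ^ α : ℝ) : ℂ) * cexp (I * (x * ξ + t * ξ ^ 4))‖ ≤
      7 * |t| ^ (-((1 + α) / 4)) := by
  rcases ht.lt_or_gt with h | h
  · have := norm_integral_half_le h0 h1 (t := -t) (by linarith) (-x) hR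
    rw [abs_of_neg h]
    refine le_trans (le_of_eq ?_) this
    rw [← RCLike.norm_conj, intervalIntegral.integral_of_le hR, intervalIntegral.integral_of_le hR,
      ← integral_conj]
    congr 2
    ext ξ
    rw [map_mul, conj_ofReal, ← exp_conj]
    congr 2
    simp
    ring
  · rw [abs_of_pos h]; exact norm_integral_half_le h0 h1 h x hR

/-- Dispersive estimate for the frequency-truncated biharmonic kernel. -/
lemma norm_kernel_le {α t : ℝ} (h0 : 0 ≤ α) (h1 : α ≤ 1) (ht : t ≠ 0) (x : ℝ) {R : ℝ}
    (hR : 0 ≤ R) :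
    ‖∫ ξ in -R..R, ((|ξ| ^ α : ℝ) : ℂ) * cexp (I * (x * ξ + t * ξ ^ 4))‖ ≤
      14 * |t| ^ (-((1 + α) / 4)) := by
  have hint : ∀ u v : ℝ, IntervalIntegrable
      (fun ξ : ℝ => ((|ξ| ^ α : ℝ) : ℂ) * cexp (I * (x * ξ + t * ξ ^ 4))) volume u v :=
    fun u v => by
      refine Continuous.intervalIntegrable ?_ u v
      have : Continuous fun x : ℝ => |x| ^ α := (Real.continuous_rpow_const h0).comp continuous_abs
      fun_prop
  rw [← intervalIntegral.integral_add_adjacent_intervals (hint (-R) 0) (hint 0 R)]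
  refine (norm_add_le _ _).trans ?_
  have hneg := intervalIntegral.integral_comp_neg (a := 0) (b := R)
    (fun ξ : ℝ => ((|ξ| ^ α : ℝ) : ℂ) * cexp (I * (x * ξ + t * ξ ^ 4)))
  rw [neg_zero] at hneg
  rw [← hneg]
  have e1 := norm_integral_half_le' h0 h1 ht x hR
  have e2 := norm_integral_half_le' h0 h1 ht (-x) hR
  have e3 : ∫ ξ in (0:ℝ)..R, ((|-ξ| ^ α : ℝ) : ℂ) * cexp (I * (x * (-ξ : ℝ) + t * (-ξ : ℝ) ^ 4))
      = ∫ ξ in (0:ℝ)..R, ((|ξ| ^ α : ℝ) : ℂ) * cexp (I * ((-x : ℝ) * ξ + t * ξ ^ 4)) := by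
    refine intervalIntegral.integral_congr fun ξ _ => ?_
    rw [abs_neg]
    congr 3
    push_cast; ring
  rw [e3]
  linarith

lemma lintegral_comp_abs_eq (g : ℝ → ℝ≥0∞) :
    ∫⁻ u : ℝ, g |u| = 2 * ∫⁻ u in Set.Ioi (0:ℝ), g u := by
  have h1 : ∫⁻ u in Set.Ioi (0:ℝ), g |u| = ∫⁻ u in Set.Ioi (0:ℝ), g u :=
    setLIntegral_congr_fun measurableSet_Ioi fun u hu => by rw [abs_of_pos hu]
  have h2 : ∫⁻ u in Set.Iio (0:ℝ), g |u| = ∫⁻ u in Set.Ioi (0:ℝ), g u := by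
    have := (Measure.measurePreserving_neg (volume : Measure ℝ)).setLIntegral_comp_emb
      (MeasurableEquiv.neg ℝ).measurableEmbedding (fun u => g |u|) (Set.Iio (0:ℝ))
    rw [← h1]
    simpa using this
  rw [← lintegral_add_compl _ (measurableSet_Ioi (a := (0:ℝ))), Set.compl_Ioi, h1,
    setLIntegral_congr (Iio_ae_eq_Iic (a := (0:ℝ))).symm, h2, two_mul]

lemma lintegral_rpow_near {γ ρ : ℝ} (h1 : γ < 1) (hρ : 0 < ρ) (t : ℝ) :
    ∫⁻ s : ℝ, (if |t - s| < ρ then ENNReal.ofReal (|t - s| ^ (-γ)) else 0) =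
      ENNReal.ofReal (2 / (1 - γ) * ρ ^ (1 - γ)) := by
  rw [lintegral_sub_left_eq_self
    (fun u : ℝ => if |u| < ρ then ENNReal.ofReal (|u| ^ (-γ)) else 0) t,
    lintegral_comp_abs_eq (fun u => if u < ρ then ENNReal.ofReal (u ^ (-γ)) else 0)]
  have h2 : ∫⁻ u in Set.Ioi (0:ℝ), (if u < ρ then ENNReal.ofReal (u ^ (-γ)) else 0)
      = ∫⁻ u in Set.Ioo (0:ℝ) ρ, ENNReal.ofReal (u ^ (-γ)) := by
    have : (fun u : ℝ => if u < ρ then ENNReal.ofReal (u ^ (-γ)) else 0)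
        = (Set.Iio ρ).indicator (fun u => ENNReal.ofReal (u ^ (-γ))) := by
      ext u; simp [Set.indicator]
    rw [this, setLIntegral_indicator measurableSet_Iio, Set.inter_comm, Set.Ioi_inter_Iio]
  rw [h2, setLIntegral_congr (Ioo_ae_eq_Ioc (a := (0:ℝ)) (b := ρ)),
    ← ofReal_integral_eq_lintegral_ofReal, ← intervalIntegral.integral_of_le hρ.le,
    integral_rpow (Or.inl (by linarith)), ← ENNReal.ofReal_ofNat,
    ← ENNReal.ofReal_mul (by norm_num), Real.zero_rpow (by linarith)]
  · congr 1
    rw [show -γ + 1 = 1 - γ by ring]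
    ring
  · exact (intervalIntegrable_iff_integrableOn_Ioc_of_le hρ.le).1
      (intervalIntegral.intervalIntegrable_rpow' (by linarith))
  · exact (ae_restrict_iff' measurableSet_Ioc).2
      (Filter.Eventually.of_forall fun u hu => Real.rpow_nonneg hu.1.le _)

lemma lintegral_rpow_far {γ ρ : ℝ} (h0 : 0 < γ) (hρ : 0 < ρ) (t : ℝ) :
    ∫⁻ s : ℝ, (if |t - s| < ρ then 0 else ENNReal.ofReal (|t - s| ^ (-γ))) ^ (2 / γ) =
      ENNReal.ofReal (2 / ρ) := by
  rw [lintegral_sub_left_eq_self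
    (fun u : ℝ => (if |u| < ρ then 0 else ENNReal.ofReal (|u| ^ (-γ))) ^ (2 / γ)) t,
    lintegral_comp_abs_eq (fun u => (if u < ρ then 0 else ENNReal.ofReal (u ^ (-γ))) ^ (2 / γ))]
  have h2 : ∫⁻ u in Set.Ioi (0:ℝ), (if u < ρ then 0 else ENNReal.ofReal (u ^ (-γ))) ^ (2 / γ)
      = ∫⁻ u in Set.Ici ρ, ENNReal.ofReal (u ^ (-2 : ℝ)) := by
    have : (fun u : ℝ => (if u < ρ then 0 else ENNReal.ofReal (u ^ (-γ))) ^ (2 / γ))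
        = (Set.Ici ρ).indicator (fun u => ENNReal.ofReal (u ^ (-2 : ℝ))) := by
      ext u
      by_cases h : u < ρ
      · have : (0:ℝ) < 2 / γ := by positivity
        simp [h, this]
      · have hu : 0 < u := by linarith
        have : u ∈ Set.Ici ρ := not_lt.1 h
        rw [if_neg h, Set.indicator_of_mem this,
          ENNReal.ofReal_rpow_of_pos (Real.rpow_pos_of_pos hu _), ← Real.rpow_mul hu.le]
        congr 2; field_simp
    rw [this, setLIntegral_indicator measurableSet_Ici, Set.inter_eq_left.2]
    exact fun u hu => lt_of_lt_of_le hρ hu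
  rw [h2, setLIntegral_congr Ioi_ae_eq_Ici.symm, ← ofReal_integral_eq_lintegral_ofReal,
    integral_Ioi_rpow_of_lt (by norm_num) hρ, ← ENNReal.ofReal_ofNat,
    ← ENNReal.ofReal_mul (by norm_num)]
  · congr 1
    norm_num
    rw [Real.rpow_neg_one]; ring
  · exact integrableOn_Ioi_rpow_of_lt (by norm_num) hρ
  · exact (ae_restrict_iff' measurableSet_Ioi).2
      (Filter.Eventually.of_forall fun u hu => Real.rpow_nonneg (hρ.trans hu).le _)

lemma lintegral_truncated_riesz_le {γ : ℝ} (h0 : 0 < γ) (h1 : γ < 1) {H : ℝ → ℝ≥0∞}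
    (hH : Measurable H) (hA0 : ∫⁻ s, H s ^ (2 / (2 - γ)) ≠ 0)
    (hA : ∫⁻ s, H s ^ (2 / (2 - γ)) ≠ ∞) {b : ℝ≥0∞} (hb0 : b ≠ 0) (hb : b ≠ ∞) (t : ℝ) :
    ∫⁻ s, (if H s ≤ b then H s * ENNReal.ofReal (|t - s| ^ (-γ)) else 0) ≤
      ENNReal.ofReal (2 / (1 - γ) + 2 ^ (γ / 2)) * (∫⁻ s, H s ^ (2 / (2 - γ))) ^ (1 - γ) *
        b ^ (2 / (2 - γ) - 1) := by
  set p : ℝ := 2 / (2 - γ) with hp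
  have hp2 : p * (2 - γ) = 2 := by rw [hp]; field_simp [show 2 - γ ≠ 0 by linarith]
  have hppos : 0 < p := by have : 0 < 2 - γ := by linarith
                           positivity
  obtain ⟨a, ha0, hae⟩ : ∃ a : ℝ, 0 < a ∧ ∫⁻ s, H s ^ p = ENNReal.ofReal a :=
    ⟨_, ENNReal.toReal_pos hA0 hA, (ENNReal.ofReal_toReal hA).symm⟩
  obtain ⟨β, hβ0, hβe⟩ : ∃ β : ℝ, 0 < β ∧ b = ENNReal.ofReal β :=
    ⟨_, ENNReal.toReal_pos hb0 hb, (ENNReal.ofReal_toReal hb).symm⟩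
  set ρ : ℝ := a / β ^ p with hρ
  have hρ0 : 0 < ρ := by positivity
  have hmeas : Measurable fun s : ℝ => ENNReal.ofReal (|t - s| ^ (-γ)) := by fun_prop
  have hset : MeasurableSet {s : ℝ | |t - s| < ρ} := measurableSet_lt (by fun_prop) (by fun_prop)
  have hm1 : Measurable fun s : ℝ =>
      (if |t - s| < ρ then ENNReal.ofReal (|t - s| ^ (-γ)) else 0) :=
    Measurable.ite hset hmeas measurable_const
  have hm2 : Measurable fun s : ℝ =>
      (if |t - s| < ρ then 0 else ENNReal.ofReal (|t - s| ^ (-γ))) :=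
    Measurable.ite hset measurable_const hmeas
  have hpq : p.HolderConjugate (2 / γ) := by
    rw [Real.holderConjugate_iff]
    refine ⟨?_, ?_⟩
    · nlinarith
    · rw [hp]; field_simp; ring
  calc ∫⁻ s, (if H s ≤ b then H s * ENNReal.ofReal (|t - s| ^ (-γ)) else 0)
      ≤ ∫⁻ s, (b * (if |t - s| < ρ then ENNReal.ofReal (|t - s| ^ (-γ)) else 0) +
          H s * (if |t - s| < ρ then 0 else ENNReal.ofReal (|t - s| ^ (-γ)))) := by
        refine lintegral_mono fun s => ?_
        dsimp only
        split_ifs with h2 h3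
        · rw [mul_zero, add_zero]; gcongr
        · rw [mul_zero, zero_add]
        · exact zero_le
        · exact zero_le
    _ = b * ENNReal.ofReal (2 / (1 - γ) * ρ ^ (1 - γ)) +
        ∫⁻ s, H s * (if |t - s| < ρ then 0 else ENNReal.ofReal (|t - s| ^ (-γ))) := by
        rw [lintegral_add_left (hm1.const_mul b), lintegral_const_mul _ hm1,
          lintegral_rpow_near h1 hρ0]
    _ ≤ b * ENNReal.ofReal (2 / (1 - γ) * ρ ^ (1 - γ)) +
        ENNReal.ofReal a ^ (1 / p) * ENNReal.ofReal (2 / ρ) ^ (1 / (2 / γ)) := by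
        gcongr
        have := ENNReal.lintegral_mul_le_Lp_mul_Lq volume hpq hH.aemeasurable hm2.aemeasurable
        rwa [hae, lintegral_rpow_far h0 hρ0] at this
    _ = ENNReal.ofReal (β * (2 / (1 - γ) * ρ ^ (1 - γ)) + a ^ (1 / p) * (2 / ρ) ^ (1 / (2 / γ))) := by
        have : 0 < 1 - γ := by linarith
        rw [hβe, ENNReal.ofReal_rpow_of_pos ha0, ENNReal.ofReal_rpow_of_pos (by positivity),
          ← ENNReal.ofReal_mul hβ0.le, ← ENNReal.ofReal_mul (by positivity),
          ← ENNReal.ofReal_add (by positivity) (by positivity)]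
    _ = ENNReal.ofReal ((2 / (1 - γ) + 2 ^ (γ / 2)) * a ^ (1 - γ) * β ^ (p - 1)) := by
        congr 1
        have e1 : β * ρ ^ (1 - γ) = a ^ (1 - γ) * β ^ (p - 1) := by
          rw [hρ, Real.div_rpow ha0.le (by positivity), ← Real.rpow_mul hβ0.le,
            show p - 1 = 1 - p * (1 - γ) by linarith, Real.rpow_sub hβ0, Real.rpow_one]
          ring
        have e2 : a ^ (1 / p) * (2 / ρ) ^ (1 / (2 / γ)) = 2 ^ (γ / 2) * a ^ (1 - γ) * β ^ (p - 1) := by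
          rw [hρ, show 2 / (a / β ^ p) = 2 * β ^ p / a by field_simp,
            show 1 / (2 / γ) = γ / 2 by field_simp, Real.div_rpow (by positivity) ha0.le,
            Real.mul_rpow (by norm_num) (by positivity), ← Real.rpow_mul hβ0.le,
            show p * (γ / 2) = p - 1 by linarith,
            show 1 - γ = 1 / p - γ / 2 by rw [hp]; field_simp; ring, Real.rpow_sub ha0]
          ring
        rw [e2]
        linear_combination 2 / (1 - γ) * e1
    _ = _ := by
        have : 0 < 1 - γ := by linarith
        rw [hβe, hae, ENNReal.ofReal_mul (by positivity), ENNReal.ofReal_mul (by positivity),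
          ENNReal.ofReal_rpow_of_pos ha0, ENNReal.ofReal_rpow_of_pos hβ0]

/-- The diagonal Hardy–Littlewood–Sobolev inequality on the line. -/
lemma lintegral_riesz_le {γ : ℝ} (h0 : 0 < γ) (h1 : γ < 1) {H : ℝ → ℝ≥0∞}
    (hH : Measurable H) (hHtop : ∀ t, H t ≠ ∞) :
    ∫⁻ t, ∫⁻ s, H t * H s * ENNReal.ofReal (|t - s| ^ (-γ)) ≤
      ENNReal.ofReal (2 * (2 / (1 - γ) + 2 ^ (γ / 2))) *
        (∫⁻ s, H s ^ (2 / (2 - γ))) ^ (2 - γ) := by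
  have hγ : 0 < 1 - γ := by linarith
  set p : ℝ := 2 / (2 - γ) with hp
  have hppos : 0 < p := by have : 0 < 2 - γ := by linarith
                           positivity
  set C : ℝ := 2 / (1 - γ) + 2 ^ (γ / 2) with hC
  have hC0 : 0 < C := by positivity
  set A := ∫⁻ s, H s ^ p with hAdef
  by_cases hA : A = ∞
  · rw [hA, ENNReal.top_rpow_of_pos (by linarith), ENNReal.mul_top]
    · exact le_top
    · simpa using hC0
  by_cases hA0 : A = 0
  · have h2 : H =ᵐ[volume] 0 := by
      have := (lintegral_eq_zero_iff (hH.pow_const p)).1 hA0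
      filter_upwards [this] with s hs
      simpa [hppos, hppos.not_gt] using hs
    have h3 : ∫⁻ t, ∫⁻ s, H t * H s * ENNReal.ofReal (|t - s| ^ (-γ)) = 0 := by
      have : (fun t => ∫⁻ s, H t * H s * ENNReal.ofReal (|t - s| ^ (-γ))) =ᵐ[volume] 0 := by
        filter_upwards [h2] with t ht
        simp [ht]
      rw [lintegral_congr_ae this]; simp
    rw [h3]; exact zero_le
  set T : ℝ → ℝ → ℝ≥0∞ := fun t s =>
    if H s ≤ H t then H t * H s * ENNReal.ofReal (|t - s| ^ (-γ)) else 0 with hT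
  have hTm : Measurable (Function.uncurry T) := by
    refine Measurable.ite (measurableSet_le (by fun_prop) (by fun_prop)) ?_ measurable_const
    fun_prop
  have hTint : ∫⁻ t, ∫⁻ s, T t s ≤ ENNReal.ofReal C * A ^ (2 - γ) := by
    have : ∀ t, ∫⁻ s, T t s ≤ ENNReal.ofReal C * A ^ (1 - γ) * H t ^ p := by
      intro t
      by_cases ht : H t = 0
      · simp [hT, ht]
      have e : ∀ s, T t s = H t * (if H s ≤ H t then H s * ENNReal.ofReal (|t - s| ^ (-γ)) else 0) := by
        intro s; simp only [hT]; split_ifs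
        · ring
        · simp
      simp_rw [e]
      rw [lintegral_const_mul' _ _ (hHtop t)]
      calc _ ≤ H t * (ENNReal.ofReal C * A ^ (1 - γ) * H t ^ (p - 1)) := by
            gcongr
            exact lintegral_truncated_riesz_le h0 h1 hH hA0 hA ht (hHtop t) t
        _ = ENNReal.ofReal C * A ^ (1 - γ) * (H t ^ (1:ℝ) * H t ^ (p - 1)) := by
            rw [ENNReal.rpow_one]; ring
        _ = _ := by
            rw [← ENNReal.rpow_add _ _ ht (hHtop t)]; congr 2; ring
    calc ∫⁻ t, ∫⁻ s, T t s ≤ ∫⁻ t, ENNReal.ofReal C * A ^ (1 - γ) * H t ^ p := lintegral_mono this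
      _ = ENNReal.ofReal C * (A ^ (1 - γ) * A ^ (1:ℝ)) := by
          rw [lintegral_const_mul _ (hH.pow_const p), ENNReal.rpow_one, mul_assoc]
      _ = _ := by rw [← ENNReal.rpow_add _ _ hA0 hA]; congr 2; ring
  calc ∫⁻ t, ∫⁻ s, H t * H s * ENNReal.ofReal (|t - s| ^ (-γ))
      ≤ ∫⁻ t, ∫⁻ s, (T t s + T s t) := by
        refine lintegral_mono fun t => lintegral_mono fun s => ?_
        simp only [hT]
        rcases le_total (H s) (H t) with h | h
        · rw [if_pos h]; exact le_self_add
        · rw [if_pos h, abs_sub_comm, mul_comm (H t)]; exact le_add_self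
    _ = (∫⁻ t, ∫⁻ s, T t s) + ∫⁻ t, ∫⁻ s, T s t := by
        have hTm' : Measurable fun t => ∫⁻ s, T t s := Measurable.lintegral_prod_right' hTm
        rw [← lintegral_add_left hTm']
        refine lintegral_congr fun t => ?_
        exact lintegral_add_left (hTm.comp measurable_prodMk_left) _
    _ = (∫⁻ t, ∫⁻ s, T t s) + ∫⁻ t, ∫⁻ s, T t s := by
        congr 1
        exact lintegral_lintegral_swap (f := fun t s => T s t) (hTm.comp measurable_swap).aemeasurable
    _ ≤ ENNReal.ofReal C * A ^ (2 - γ) + ENNReal.ofReal C * A ^ (2 - γ) := by gcongr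
    _ = _ := by
        rw [ENNReal.ofReal_mul (by norm_num), ENNReal.ofReal_ofNat]; ring

/-- A `T T^*` bound for oscillatory integral operators with unimodular kernel. -/
lemma lintegral_mul_norm_sq_oscillatory_le {m : ℝ → ℝ} (hm : Integrable m) (m0 : ∀ x, 0 ≤ m x)
    {φ : ℝ → ℝ → ℝ} (hφ : Measurable (Function.uncurry φ)) {h : ℝ → ℂ} (hh : Integrable h) :
    ∫⁻ x, ENNReal.ofReal (m x) * ‖∫ y, cexp (I * φ x y) * h y‖ₑ ^ 2 ≤
      ∫⁻ y, ∫⁻ z, ‖h y‖ₑ * ‖h z‖ₑ * ‖∫ x, (m x : ℂ) * cexp (I * (φ x y - φ x z))‖ₑ := by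
  set P : ℝ → ℂ := fun x => ∫ y, cexp (I * φ x y) * h y with hP
  have hhc : Integrable (fun z => (starRingEnd ℂ) (h z)) :=
    ⟨continuous_conj.comp_aestronglyMeasurable hh.1, by
      simpa [HasFiniteIntegral, enorm_eq_nnnorm] using! hh.2⟩
  set Φ : ℝ → ℝ × ℝ → ℂ := fun x p =>
    cexp (I * (φ x p.1 - φ x p.2)) * ((m x : ℂ) * (h p.1 * (starRingEnd ℂ) (h p.2))) with hΦ
  have hΦi : Integrable (Function.uncurry Φ) (volume.prod (volume.prod volume)) := by
    have h0 : Integrable (fun q : ℝ × ℝ × ℝ => (m q.1 : ℂ) * (h q.2.1 * (starRingEnd ℂ) (h q.2.2)))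
        (volume.prod (volume.prod volume)) := (hm.ofReal (𝕜 := ℂ)).mul_prod (hh.mul_prod hhc)
    refine h0.bdd_mul (c := 1) ?_ (Filter.Eventually.of_forall fun q => ?_)
    · have h1 : Measurable fun q : ℝ × ℝ × ℝ => φ q.1 q.2.1 :=
        hφ.comp (measurable_fst.prodMk (measurable_fst.comp measurable_snd))
      have h2 : Measurable fun q : ℝ × ℝ × ℝ => φ q.1 q.2.2 :=
        hφ.comp (measurable_fst.prodMk (measurable_snd.comp measurable_snd))
      exact Measurable.aestronglyMeasurable (by fun_prop)
    · have := norm_exp_ofReal_mul_I (φ q.1 q.2.1 - φ q.1 q.2.2)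
      rw [mul_comm] at this
      push_cast at this
      exact this.le
  have hPΦ : ∀ x, ∫ p, Φ x p = ((m x * ‖P x‖ ^ 2 : ℝ) : ℂ) := fun x => by
    have h1 : ∫ p, Φ x p = ∫ p : ℝ × ℝ, (m x : ℂ) * ((cexp (I * φ x p.1) * h p.1) *
        (starRingEnd ℂ) (cexp (I * φ x p.2) * h p.2)) := by
      congr 1; ext p
      simp only [hΦ]
      rw [map_mul, ← exp_conj, map_mul, conj_I, conj_ofReal, mul_sub, sub_eq_add_neg, exp_add,
        neg_mul]
      ring
    rw [h1, integral_const_mul, Measure.volume_eq_prod, integral_prod_mul (fun y => cexp (I * φ x y) * h y)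
      (fun z => (starRingEnd ℂ) (cexp (I * φ x z) * h z)), integral_conj, mul_conj, normSq_eq_norm_sq]
    push_cast; rfl
  have hFi : Integrable fun x => m x * ‖P x‖ ^ 2 := by
    have := hΦi.integral_prod_left
    have h2 : Integrable (fun x => ((m x * ‖P x‖ ^ 2 : ℝ) : ℂ)) := by
      refine this.congr (Filter.Eventually.of_forall fun x => ?_)
      exact hPΦ x
    exact h2.re
  calc ∫⁻ x, ENNReal.ofReal (m x) * ‖P x‖ₑ ^ 2 = ∫⁻ x, ENNReal.ofReal (m x * ‖P x‖ ^ 2) := by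
        refine lintegral_congr fun x => ?_
        rw [ENNReal.ofReal_mul (m0 x), ENNReal.ofReal_pow (norm_nonneg _), ofReal_norm]
    _ = ‖∫ x, ((m x * ‖P x‖ ^ 2 : ℝ) : ℂ)‖ₑ := by
        rw [← ofReal_integral_eq_lintegral_ofReal hFi
          (Filter.Eventually.of_forall fun x => mul_nonneg (m0 x) (sq_nonneg _)),
          integral_complex_ofReal, ← ofReal_norm, norm_real, Real.norm_of_nonneg]
        exact integral_nonneg fun x => mul_nonneg (m0 x) (sq_nonneg _)
    _ = ‖∫ p, ∫ x, Φ x p‖ₑ := by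
        simp_rw [← hPΦ]
        rw [Measure.volume_eq_prod, integral_integral_swap hΦi]
    _ ≤ ∫⁻ p, ‖∫ x, Φ x p‖ₑ := enorm_integral_le_lintegral_enorm _
    _ = ∫⁻ y, ∫⁻ z, ‖∫ x, Φ x (y, z)‖ₑ := by
        rw [Measure.volume_eq_prod, lintegral_prod]
        exact hΦi.integral_prod_right.aestronglyMeasurable.enorm
    _ = _ := by
        refine lintegral_congr fun y => lintegral_congr fun z => ?_
        have : ∫ x, Φ x (y, z) = (h y * (starRingEnd ℂ) (h z)) *
            ∫ x, (m x : ℂ) * cexp (I * (φ x y - φ x z)) := by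
          rw [← integral_const_mul]
          congr 1; ext x; simp only [hΦ]; ring
        rw [this, enorm_mul, enorm_mul, ← ofReal_norm ((starRingEnd ℂ) (h z)),
          RCLike.norm_conj, ofReal_norm]

lemma norm_cexp_I_mul_ofReal (x : ℝ) : ‖cexp (I * x)‖ = 1 := by
  rw [mul_comm, norm_exp_ofReal_mul_I]

lemma integral_gaussian_mul_cexp {ε : ℝ} (hε : 0 < ε) (u : ℝ) :
    ∫ x : ℝ, ((Real.exp (-ε * x ^ 2) : ℝ) : ℂ) * cexp (I * (u * x : ℝ)) =
      ((√(Real.pi / ε) * Real.exp (-u ^ 2 / (4 * ε)) : ℝ) : ℂ) := by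
  have := fourierIntegral_gaussian (b := (ε : ℂ)) (by simpa using hε) (u : ℂ)
  have h2 : ((Real.pi : ℂ) / ε) ^ (1 / 2 : ℂ) = ((√(Real.pi / ε) : ℝ) : ℂ) := by
    rw [Real.sqrt_eq_rpow, ofReal_cpow (by positivity)]
    push_cast; rfl
  rw [h2] at this
  push_cast
  rw [← this]
  congr 1; ext x
  rw [mul_comm]
  congr 2
  ring

/-- The (unnormalised) oscillatory extension `x ↦ ∫ e^{ixξ} f(ξ) dξ`. -/
noncomputable def osc (f : ℝ → ℂ) (x : ℝ) : ℂ := ∫ ξ : ℝ, cexp (I * (x * ξ : ℝ)) * f ξ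

lemma continuous_integral_cexp {X : Type*} [TopologicalSpace X] [FirstCountableTopology X]
    {φ : X → ℝ → ℝ} (h1 : ∀ ξ, Continuous fun x => φ x ξ) (h2 : ∀ x, Measurable (φ x))
    {f : ℝ → ℂ} (hf : Integrable f) : Continuous fun x => ∫ ξ, cexp (I * φ x ξ) * f ξ := by
  refine continuous_of_dominated (bound := fun ξ => ‖f ξ‖) (fun x => ?_) (fun x => ?_) hf.norm ?_
  · have := h2 x
    exact (Measurable.aestronglyMeasurable (by fun_prop)).mul hf.1
  · exact Filter.Eventually.of_forall fun ξ => by rw [norm_mul, norm_cexp_I_mul_ofReal, one_mul]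
  · refine Filter.Eventually.of_forall fun ξ => ?_
    have := h1 ξ
    fun_prop

lemma continuous_osc {f : ℝ → ℂ} (hf : Integrable f) : Continuous (osc f) :=
  continuous_integral_cexp (fun ξ => by fun_prop) (fun x => by fun_prop) hf

lemma lintegral_gaussian_mass {ε : ℝ} (hε : 0 < ε) (y : ℝ) :
    ∫⁻ z : ℝ, ENNReal.ofReal (√(Real.pi / ε) * Real.exp (-(y - z) ^ 2 / (4 * ε))) =
      ENNReal.ofReal (2 * Real.pi) := by
  rw [lintegral_sub_left_eq_self
    (fun u : ℝ => ENNReal.ofReal (√(Real.pi / ε) * Real.exp (-u ^ 2 / (4 * ε)))) y]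
  have h1 : ∀ u : ℝ, Real.exp (-u ^ 2 / (4 * ε)) = Real.exp (-(1 / (4 * ε)) * u ^ 2) := fun u => by
    congr 1; field_simp
  simp_rw [h1]
  rw [← ofReal_integral_eq_lintegral_ofReal
    ((integrable_exp_neg_mul_sq (by positivity)).const_mul _)
    (Filter.Eventually.of_forall fun u => by positivity), integral_const_mul, integral_gaussian,
    ← Real.sqrt_mul (by positivity)]
  congr 1
  rw [show Real.pi / ε * (Real.pi / (1 / (4 * ε))) = (2 * Real.pi) ^ 2 by field_simp; ring,
    Real.sqrt_sq (by positivity)]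

lemma lintegral_gaussian_mul_osc_sq_le {f : ℝ → ℂ} (hf : Integrable f) {ε : ℝ} (hε : 0 < ε) :
    ∫⁻ x, ENNReal.ofReal (Real.exp (-ε * x ^ 2)) * ‖osc f x‖ₑ ^ 2 ≤
      ENNReal.ofReal (2 * Real.pi) * ∫⁻ ξ, ‖f ξ‖ₑ ^ 2 := by
  set G : ℝ → ℝ≥0∞ := fun u => ENNReal.ofReal (√(Real.pi / ε) * Real.exp (-u ^ 2 / (4 * ε)))
  have hG : Measurable G := by fun_prop
  have hfm : AEMeasurable (fun ξ => ‖f ξ‖ₑ ^ 2) := hf.1.enorm.pow_const 2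
  refine (lintegral_mul_norm_sq_oscillatory_le (integrable_exp_neg_mul_sq hε)
    (fun x => (Real.exp_pos _).le) (φ := fun x ξ => x * ξ)
    (measurable_fst.mul measurable_snd) hf).trans ?_
  have h2 : ∀ y z : ℝ, ‖∫ x : ℝ, ((Real.exp (-ε * x ^ 2) : ℝ) : ℂ) *
      cexp (I * ((x * y : ℝ) - (x * z : ℝ)))‖ₑ = G (y - z) := fun y z => by
    have h3 := integral_gaussian_mul_cexp hε (y - z)
    have h4 : ∀ x : ℝ, (((x * y : ℝ) : ℂ) - (x * z : ℝ)) = ((y - z) * x : ℝ) := fun x => by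
      push_cast; ring
    simp_rw [h4]
    rw [h3, ← ofReal_norm, norm_real, Real.norm_of_nonneg (by positivity)]
  simp_rw [h2]
  have h5 : ∀ p q : ℝ≥0∞, p * q ≤ 2⁻¹ * p ^ 2 + 2⁻¹ * q ^ 2 := fun p q => by
    have h := ENNReal.young_inequality p q Real.HolderConjugate.two_two
    rw [ENNReal.ofReal_ofNat, ENNReal.rpow_two, ENNReal.rpow_two, div_eq_mul_inv,
      div_eq_mul_inv] at h
    rwa [mul_comm 2⁻¹, mul_comm 2⁻¹]
  calc ∫⁻ y, ∫⁻ z, ‖f y‖ₑ * ‖f z‖ₑ * G (y - z)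
      ≤ ∫⁻ y, ∫⁻ z, ((2⁻¹ * ‖f y‖ₑ ^ 2) * G (y - z) + (2⁻¹ * ‖f z‖ₑ ^ 2) * G (y - z)) := by
        refine lintegral_mono fun y => lintegral_mono fun z => ?_
        rw [← add_mul]
        gcongr
        exact h5 _ _
    _ = ∫⁻ y, ((2⁻¹ * ‖f y‖ₑ ^ 2) * ENNReal.ofReal (2 * Real.pi) +
          ∫⁻ z, (2⁻¹ * ‖f z‖ₑ ^ 2) * G (y - z)) := by
        refine lintegral_congr fun y => ?_
        have hGy : Measurable fun z => G (y - z) := by fun_prop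
        rw [lintegral_add_left' , lintegral_const_mul _ hGy, lintegral_gaussian_mass hε y]
        exact (hGy.const_mul _).aemeasurable
    _ = 2⁻¹ * (ENNReal.ofReal (2 * Real.pi) * ∫⁻ ξ, ‖f ξ‖ₑ ^ 2) +
          ∫⁻ z, ∫⁻ y, (2⁻¹ * ‖f z‖ₑ ^ 2) * G (y - z) := by
        rw [lintegral_add_left' ((hfm.const_mul _).mul_const _), lintegral_lintegral_swap]
        · congr 1
          rw [lintegral_mul_const'' _ (hfm.const_mul _), lintegral_const_mul'' _ hfm]
          ring
        · refine AEMeasurable.mul ?_ ?_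
          · exact (hfm.const_mul _).comp_quasiMeasurePreserving Measure.quasiMeasurePreserving_snd
          · exact (hG.comp (measurable_fst.sub measurable_snd)).aemeasurable
    _ = 2⁻¹ * (ENNReal.ofReal (2 * Real.pi) * ∫⁻ ξ, ‖f ξ‖ₑ ^ 2) +
          2⁻¹ * (ENNReal.ofReal (2 * Real.pi) * ∫⁻ ξ, ‖f ξ‖ₑ ^ 2) := by
        congr 1
        have : ∀ z, ∫⁻ y, (2⁻¹ * ‖f z‖ₑ ^ 2) * G (y - z)
            = (2⁻¹ * ‖f z‖ₑ ^ 2) * ENNReal.ofReal (2 * Real.pi) := fun z => by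
          rw [lintegral_const_mul _ (by fun_prop), ← lintegral_gaussian_mass hε z]
          congr 1
          refine lintegral_congr fun y => ?_
          simp only [G]
          rw [show (y - z) ^ 2 = (z - y) ^ 2 by ring]
        simp_rw [this]
        rw [lintegral_mul_const'' _ (hfm.const_mul _), lintegral_const_mul'' _ hfm]
        ring
    _ = _ := by rw [← add_mul, ENNReal.inv_two_add_inv_two, one_mul]

lemma lintegral_osc_sq_le {f : ℝ → ℂ} (hf : Integrable f) :
    ∫⁻ x, ‖osc f x‖ₑ ^ 2 ≤ ENNReal.ofReal (2 * Real.pi) * ∫⁻ ξ, ‖f ξ‖ₑ ^ 2 := by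
  set F : ℕ → ℝ → ℝ≥0∞ := fun n x =>
    ENNReal.ofReal (Real.exp (-(1 / ((n : ℝ) + 1)) * x ^ 2)) * ‖osc f x‖ₑ ^ 2 with hF
  have hc := (continuous_osc hf).measurable
  have hlim : ∀ x, Filter.Tendsto (fun n => F n x) Filter.atTop (nhds (‖osc f x‖ₑ ^ 2)) := by
    intro x
    have h1 : Filter.Tendsto (fun n : ℕ => Real.exp (-(1 / ((n : ℝ) + 1)) * x ^ 2)) Filter.atTop
        (nhds 1) := by
      have h2 := ((tendsto_one_div_add_atTop_nhds_zero_nat (𝕜 := ℝ)).neg.mul_const (x ^ 2))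
      rw [neg_zero, zero_mul] at h2
      simpa using! (Real.continuous_exp.tendsto 0).comp h2
    have h3 := ENNReal.Tendsto.mul_const (b := ‖osc f x‖ₑ ^ 2) (ENNReal.tendsto_ofReal h1)
      (Or.inr (by simp))
    rwa [ENNReal.ofReal_one, one_mul] at h3
  calc ∫⁻ x, ‖osc f x‖ₑ ^ 2 = ∫⁻ x, Filter.liminf (fun n => F n x) Filter.atTop :=
        lintegral_congr fun x => (hlim x).liminf_eq.symm
    _ ≤ Filter.liminf (fun n => ∫⁻ x, F n x) Filter.atTop :=
        lintegral_liminf_le fun n => by fun_prop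
    _ ≤ _ := Filter.liminf_le_of_le (by isBoundedDefault) fun b hb => by
        obtain ⟨n, hn⟩ := hb.exists
        exact hn.trans (lintegral_gaussian_mul_osc_sq_le hf (by positivity))

lemma norm_osc_gaussian_mul_le {g : ℝ → ℂ} (hg : Integrable g) {B : ℝ} (hB : ∀ x, ‖osc g x‖ ≤ B)
    {s : ℝ} (hs : 0 < s) (x : ℝ) :
    ‖osc (fun ξ => ((Real.exp (-s * ξ ^ 2) : ℝ) : ℂ) * g ξ) x‖ ≤ B := by
  set ε : ℝ := 1 / (4 * s) with hε
  have hε0 : 0 < ε := by positivity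
  have hm : 0 < √(Real.pi / ε) := by positivity
  have hgauss := integrable_exp_neg_mul_sq hε0
  have key : ((√(Real.pi / ε) : ℝ) : ℂ) * osc (fun ξ => ((Real.exp (-s * ξ ^ 2) : ℝ) : ℂ) * g ξ) x =
      ∫ y, ((Real.exp (-ε * y ^ 2) : ℝ) : ℂ) * osc g (x + y) := by
    have h1 : ∀ ξ : ℝ, ((√(Real.pi / ε) : ℝ) : ℂ) *
        (cexp (I * (x * ξ : ℝ)) * (((Real.exp (-s * ξ ^ 2) : ℝ) : ℂ) * g ξ)) =
        ∫ y : ℝ, ((Real.exp (-ε * y ^ 2) : ℝ) : ℂ) * (cexp (I * ((x + y) * ξ : ℝ)) * g ξ) := by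
      intro ξ
      have h2 := integral_gaussian_mul_cexp hε0 ξ
      have h3 : -ξ ^ 2 / (4 * ε) = -s * ξ ^ 2 := by rw [hε]; field_simp
      rw [h3] at h2
      have h4 : ∀ y : ℝ, ((Real.exp (-ε * y ^ 2) : ℝ) : ℂ) * (cexp (I * ((x + y) * ξ : ℝ)) * g ξ) =
          (((Real.exp (-ε * y ^ 2) : ℝ) : ℂ) * cexp (I * (ξ * y : ℝ))) *
            (cexp (I * (x * ξ : ℝ)) * g ξ) := fun y => by
        rw [show I * ((x + y) * ξ : ℝ) = I * (ξ * y : ℝ) + I * (x * ξ : ℝ) by push_cast; ring,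
          Complex.exp_add]
        ring
      simp_rw [h4]
      rw [integral_mul_const, h2]
      push_cast; ring
    rw [osc, ← integral_const_mul]
    simp_rw [h1]
    rw [integral_integral_swap]
    · refine integral_congr_ae (Filter.Eventually.of_forall fun y => ?_)
      simp only [osc]
      rw [← integral_const_mul]
    · have h5 : Integrable (fun z : ℝ × ℝ => g z.1 * ((Real.exp (-ε * z.2 ^ 2) : ℝ) : ℂ))
          (volume.prod volume) := hg.mul_prod hgauss.ofReal
      have h6 := h5.bdd_mul (c := 1) (f := fun z : ℝ × ℝ => cexp (I * ((x + z.2) * z.1 : ℝ)))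
        (Measurable.aestronglyMeasurable (by fun_prop))
        (Filter.Eventually.of_forall fun z => (norm_cexp_I_mul_ofReal _).le)
      refine h6.congr (Filter.Eventually.of_forall fun z => ?_)
      simp only [Function.uncurry]
      ring
  have h7 : ‖∫ y, ((Real.exp (-ε * y ^ 2) : ℝ) : ℂ) * osc g (x + y)‖ ≤ √(Real.pi / ε) * B := by
    rw [← integral_gaussian, ← integral_mul_const]
    refine norm_integral_le_of_norm_le (hgauss.mul_const B) (Filter.Eventually.of_forall fun y => ?_)
    rw [norm_mul, norm_real, Real.norm_of_nonneg (Real.exp_pos _).le]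
    exact mul_le_mul_of_nonneg_left (hB _) (Real.exp_pos _).le
  rw [← key, norm_mul, norm_real, Real.norm_of_nonneg hm.le] at h7
  exact le_of_mul_le_mul_left h7 hm

lemma lintegral_rpow_mul_exp_neg_mul {c b : ℝ} (hc : 0 < c) (hb : 0 < b) :
    ∫⁻ s in Set.Ioi (0:ℝ), ENNReal.ofReal (s ^ (c - 1) * Real.exp (-(b * s))) =
      ENNReal.ofReal ((1 / b) ^ c * Real.Gamma c) := by
  rw [← Real.integral_rpow_mul_exp_neg_mul_Ioi hc hb, ofReal_integral_eq_lintegral_ofReal]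
  · have := integrableOn_rpow_mul_exp_neg_mul_rpow (p := 1) (s := c - 1) (b := b) (by linarith)
      one_pos hb
    simpa [IntegrableOn] using this
  · refine (ae_restrict_mem measurableSet_Ioi).mono fun s hs => ?_
    have : (0:ℝ) < s := hs
    show 0 ≤ _
    positivity

/-- The heat-regularised extension used in the Littlewood–Paley-type square function. -/
noncomputable def heatOsc (a : ℝ) (f : ℝ → ℂ) (s x : ℝ) : ℂ :=
  osc (fun ξ => ((Real.exp (-s * ξ ^ 2) : ℝ) : ℂ) * (((|ξ| ^ a : ℝ) : ℂ) * f ξ)) x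

lemma measurable_heatOsc {a : ℝ} {f : ℝ → ℂ} (hf : Measurable f) :
    Measurable (Function.uncurry (heatOsc a f)) := by
  have : StronglyMeasurable (fun z : ℝ × ℝ => ∫ ξ : ℝ, cexp (I * (z.2 * ξ : ℝ)) *
      (((Real.exp (-z.1 * ξ ^ 2) : ℝ) : ℂ) * (((|ξ| ^ a : ℝ) : ℂ) * f ξ))) := by
    refine StronglyMeasurable.integral_prod_right' (f := fun w : (ℝ × ℝ) × ℝ =>
      cexp (I * (w.1.2 * w.2 : ℝ)) *
      (((Real.exp (-w.1.1 * w.2 ^ 2) : ℝ) : ℂ) * (((|w.2| ^ a : ℝ) : ℂ) * f w.2))) ?_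
    refine Measurable.stronglyMeasurable ?_
    fun_prop
  exact this.measurable

lemma ofReal_Gamma_mul_enorm_osc_le {a θ : ℝ} (ha : 0 < a) (hθ : 0 < θ) (hθ1 : θ < 1) {f : ℝ → ℂ}
    (hfm : Measurable f) (hf : Integrable f) (hfa : Integrable fun ξ => ((|ξ| ^ a : ℝ) : ℂ) * f ξ)
    (x : ℝ) :
    ENNReal.ofReal (Real.Gamma (a * (1 - θ) / 2)) *
        ‖osc (fun ξ => ((|ξ| ^ (θ * a) : ℝ) : ℂ) * f ξ) x‖ₑ ≤
      ∫⁻ s in Set.Ioi (0:ℝ), ENNReal.ofReal (s ^ (a * (1 - θ) / 2 - 1)) * ‖heatOsc a f s x‖ₑ := by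
  set c := a * (1 - θ) / 2 with hc
  have hc0 : 0 < c := by have : 0 < 1 - θ := by linarith
                         positivity
  have hΓ := Real.Gamma_pos_of_pos hc0
  have hpow : ∀ ξ : ℝ, ξ ≠ 0 → |ξ| ^ a * (1 / ξ ^ 2) ^ c = |ξ| ^ (θ * a) := by
    intro ξ hξ
    have h0 : 0 < |ξ| := abs_pos.mpr hξ
    rw [← sq_abs, one_div, Real.inv_rpow (by positivity), ← Real.rpow_natCast,
      ← Real.rpow_mul h0.le, ← Real.rpow_neg h0.le, ← Real.rpow_add h0]
    congr 1
    rw [hc]; push_cast; ring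
  set K : ℝ → ℝ → ℂ := fun ξ s => ((s ^ (c - 1) : ℝ) : ℂ) * (cexp (I * (x * ξ : ℝ)) *
    (((Real.exp (-s * ξ ^ 2) : ℝ) : ℂ) * (((|ξ| ^ a : ℝ) : ℂ) * f ξ))) with hK
  have hKm : Measurable (Function.uncurry K) := by
    simp only [hK, Function.uncurry_def]; fun_prop
  have hKn : ∀ ξ, ∀ s ∈ Set.Ioi (0:ℝ), ‖K ξ s‖ₑ =
      ENNReal.ofReal (|ξ| ^ a) * ‖f ξ‖ₑ *
        ENNReal.ofReal (s ^ (c - 1) * Real.exp (-(ξ ^ 2 * s))) := by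
    intro ξ s hs
    have hs' : (0:ℝ) < s := hs
    simp only [hK, enorm_mul]
    rw [← ofReal_norm (cexp _), norm_cexp_I_mul_ofReal, ENNReal.ofReal_one, one_mul,
      ← ofReal_norm ((_ : ℝ) : ℂ), norm_real, Real.norm_of_nonneg (by positivity),
      ← ofReal_norm ((Real.exp _ : ℝ) : ℂ), norm_real, Real.norm_of_nonneg (by positivity),
      ← ofReal_norm ((|ξ| ^ a : ℝ) : ℂ), norm_real, Real.norm_of_nonneg (by positivity),
      ENNReal.ofReal_mul (by positivity), show -s * ξ ^ 2 = -(ξ ^ 2 * s) by ring]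
    ring
  have hfθ : Integrable fun ξ => ((|ξ| ^ (θ * a) : ℝ) : ℂ) * f ξ := by
    refine (hf.norm.add hfa.norm).mono' (by fun_prop) (Filter.Eventually.of_forall fun ξ => ?_)
    simp only [norm_mul, norm_real, Pi.add_apply]
    rw [Real.norm_of_nonneg (by positivity), Real.norm_of_nonneg (by positivity)]
    have : |ξ| ^ (θ * a) ≤ 1 + |ξ| ^ a := by
      rcases le_total |ξ| 1 with h | h
      · have := Real.rpow_le_one (abs_nonneg ξ) h (by positivity : 0 ≤ θ * a)
        have : 0 ≤ |ξ| ^ a := by positivity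
        linarith
      · have := Real.rpow_le_rpow_of_exponent_le h (show θ * a ≤ a by nlinarith)
        linarith
    nlinarith [norm_nonneg (f ξ)]
  have hne : ∀ᵐ ξ : ℝ, ξ ≠ 0 := by simp [ae_iff, measure_singleton]
  have hKint : Integrable (Function.uncurry K) (volume.prod (volume.restrict (Set.Ioi 0))) := by
    refine ⟨hKm.aestronglyMeasurable, ?_⟩
    rw [hasFiniteIntegral_iff_enorm, lintegral_prod _ hKm.enorm.aemeasurable]
    have : ∀ᵐ ξ : ℝ, ∫⁻ s in Set.Ioi (0:ℝ), ‖Function.uncurry K (ξ, s)‖ₑ =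
        ENNReal.ofReal (Real.Gamma c) * ‖((|ξ| ^ (θ * a) : ℝ) : ℂ) * f ξ‖ₑ := by
      filter_upwards [hne] with ξ hξ
      refine (setLIntegral_congr_fun measurableSet_Ioi (hKn ξ)).trans ?_
      rw [lintegral_const_mul _ (by fun_prop),
        lintegral_rpow_mul_exp_neg_mul hc0 (by positivity), enorm_mul,
        ← ofReal_norm ((|ξ| ^ (θ * a) : ℝ) : ℂ), norm_real, Real.norm_of_nonneg (by positivity),
        ← hpow ξ hξ, ENNReal.ofReal_mul (by positivity), ENNReal.ofReal_mul (by positivity)]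
      ring
    rw [lintegral_congr_ae this, lintegral_const_mul'' _ hfθ.1.enorm]
    exact ENNReal.mul_lt_top ENNReal.ofReal_lt_top hfθ.2
  have key : ((Real.Gamma c : ℝ) : ℂ) * osc (fun ξ => ((|ξ| ^ (θ * a) : ℝ) : ℂ) * f ξ) x =
      ∫ s in Set.Ioi (0:ℝ), ((s ^ (c - 1) : ℝ) : ℂ) * heatOsc a f s x := by
    have h1 : ∀ᵐ ξ : ℝ, ((Real.Gamma c : ℝ) : ℂ) *
        (cexp (I * (x * ξ : ℝ)) * (((|ξ| ^ (θ * a) : ℝ) : ℂ) * f ξ)) =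
        ∫ s in Set.Ioi (0:ℝ), K ξ s := by
      filter_upwards [hne] with ξ hξ
      have h2 : ∀ s : ℝ, K ξ s = ((s ^ (c - 1) * Real.exp (-(ξ ^ 2 * s)) : ℝ) : ℂ) *
          (cexp (I * (x * ξ : ℝ)) * (((|ξ| ^ a : ℝ) : ℂ) * f ξ)) := fun s => by
        simp only [hK]
        rw [show -s * ξ ^ 2 = -(ξ ^ 2 * s) by ring]
        push_cast; ring
      simp_rw [h2]
      rw [integral_mul_const, integral_complex_ofReal,
        Real.integral_rpow_mul_exp_neg_mul_Ioi hc0 (by positivity), ← hpow ξ hξ]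
      push_cast; ring
    rw [osc, ← integral_const_mul, integral_congr_ae h1, integral_integral_swap hKint]
    refine integral_congr_ae (Filter.Eventually.of_forall fun s => ?_)
    simp only [hK, heatOsc, osc]
    rw [← integral_const_mul]
  rw [show ENNReal.ofReal (Real.Gamma c) = ‖((Real.Gamma c : ℝ) : ℂ)‖ₑ by
    rw [← ofReal_norm, norm_real, Real.norm_of_nonneg hΓ.le], ← enorm_mul, key]
  refine (enorm_integral_le_lintegral_enorm _).trans (le_of_eq ?_)
  refine setLIntegral_congr_fun measurableSet_Ioi fun s hs => ?_
  have hs' : (0:ℝ) < s := hs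
  simp only [enorm_mul]
  rw [← ofReal_norm ((_ : ℝ) : ℂ), norm_real, Real.norm_of_nonneg (by positivity)]

lemma lintegral_heatOsc_square_function_le {a : ℝ} (ha : 0 < a) {f : ℝ → ℂ} (hfm : Measurable f)
    (hfa : Integrable fun ξ => ((|ξ| ^ a : ℝ) : ℂ) * f ξ) :
    ∫⁻ x, ∫⁻ s in Set.Ioi (0:ℝ), ENNReal.ofReal (s ^ (a - 1)) * ‖heatOsc a f s x‖ₑ ^ 2 ≤
      ENNReal.ofReal (2 * Real.pi) * ENNReal.ofReal (Real.Gamma a) * ∫⁻ ξ, ‖f ξ‖ₑ ^ 2 := by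
  have hW := measurable_heatOsc (a := a) hfm
  have hne : ∀ᵐ ξ : ℝ, ξ ≠ 0 := by simp [ae_iff, measure_singleton]
  rw [lintegral_lintegral_swap]
  swap
  · have : Measurable fun z : ℝ × ℝ => ‖Function.uncurry (heatOsc a f) (z.2, z.1)‖ₑ := by fun_prop
    simp only [Function.uncurry] at this
    simp only [Function.uncurry_def]
    fun_prop
  have h1 : ∀ s ∈ Set.Ioi (0:ℝ), ∫⁻ x, ENNReal.ofReal (s ^ (a - 1)) * ‖heatOsc a f s x‖ₑ ^ 2 ≤
      ENNReal.ofReal (2 * Real.pi) * ∫⁻ ξ, ENNReal.ofReal (|ξ| ^ a) ^ 2 * ‖f ξ‖ₑ ^ 2 *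
        ENNReal.ofReal (s ^ (a - 1) * Real.exp (-(2 * ξ ^ 2 * s))) := by
    intro s hs
    have hs' : (0:ℝ) < s := hs
    have hint : Integrable fun ξ => ((Real.exp (-s * ξ ^ 2) : ℝ) : ℂ) * (((|ξ| ^ a : ℝ) : ℂ) * f ξ) := by
      refine hfa.bdd_mul (c := 1) (by fun_prop) (Filter.Eventually.of_forall fun ξ => ?_)
      rw [norm_real, Real.norm_of_nonneg (Real.exp_pos _).le, Real.exp_le_one_iff]
      nlinarith [sq_nonneg ξ]
    rw [lintegral_const_mul' _ _ ENNReal.ofReal_ne_top]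
    calc _ ≤ ENNReal.ofReal (s ^ (a - 1)) * (ENNReal.ofReal (2 * Real.pi) * _) :=
          mul_le_mul_right (lintegral_osc_sq_le hint) _
      _ = _ := by
          rw [mul_left_comm, ← lintegral_const_mul' _ _ ENNReal.ofReal_ne_top]
          congr 1
          refine lintegral_congr fun ξ => ?_
          rw [enorm_mul, enorm_mul, ← ofReal_norm ((Real.exp _ : ℝ) : ℂ), norm_real,
            Real.norm_of_nonneg (by positivity), ← ofReal_norm ((|ξ| ^ a : ℝ) : ℂ), norm_real,
            Real.norm_of_nonneg (by positivity), ENNReal.ofReal_mul (by positivity),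
            show -(2 * ξ ^ 2 * s) = -s * ξ ^ 2 + -s * ξ ^ 2 by ring, Real.exp_add,
            ENNReal.ofReal_mul (by positivity)]
          ring
  refine (setLIntegral_mono' measurableSet_Ioi h1).trans ?_
  rw [lintegral_const_mul' _ _ ENNReal.ofReal_ne_top, mul_assoc]
  refine mul_le_mul_right ?_ _
  rw [lintegral_lintegral_swap]
  swap
  · simp only [Function.uncurry_def]; fun_prop
  rw [← lintegral_const_mul' _ _ ENNReal.ofReal_ne_top]
  refine lintegral_mono_ae ?_
  filter_upwards [hne] with ξ hξ
  have h0 : 0 < |ξ| := abs_pos.mpr hξ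
  rw [lintegral_const_mul _ (by fun_prop), lintegral_rpow_mul_exp_neg_mul ha (by positivity),
    ENNReal.ofReal_mul (by positivity)]
  have h2 : ENNReal.ofReal (|ξ| ^ a) ^ 2 * ENNReal.ofReal ((1 / (2 * ξ ^ 2)) ^ a) ≤ 1 := by
    rw [← ENNReal.ofReal_pow (by positivity), ← ENNReal.ofReal_mul (by positivity)]
    rw [ENNReal.ofReal_le_one, ← Real.rpow_natCast, ← Real.rpow_mul h0.le, mul_comm a,
      Real.rpow_mul h0.le, ← Real.mul_rpow (by positivity) (by positivity)]
    refine Real.rpow_le_one (by positivity) ?_ ha.le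
    rw [← sq_abs ξ]; push_cast
    rw [Real.rpow_ofNat]; field_simp; norm_num
  calc _ = (ENNReal.ofReal (|ξ| ^ a) ^ 2 * ENNReal.ofReal ((1 / (2 * ξ ^ 2)) ^ a)) *
        (ENNReal.ofReal (Real.Gamma a) * ‖f ξ‖ₑ ^ 2) := by ring
    _ ≤ 1 * (ENNReal.ofReal (Real.Gamma a) * ‖f ξ‖ₑ ^ 2) := mul_le_mul_left h2 _
    _ = _ := one_mul _

lemma lintegral_Ioc_rpow {c S : ℝ} (hc : 0 < c) (hS : 0 ≤ S) :
    ∫⁻ s in Set.Ioc 0 S, ENNReal.ofReal (s ^ (c - 1)) = ENNReal.ofReal (S ^ c / c) := by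
  rw [← ofReal_integral_eq_lintegral_ofReal, ← intervalIntegral.integral_of_le hS,
    integral_rpow (Or.inl (by linarith))]
  · simp [Real.zero_rpow hc.ne']
  · have := intervalIntegral.intervalIntegrable_rpow' (a := 0) (b := S) (r := c - 1) (by linarith)
    rwa [intervalIntegrable_iff_integrableOn_Ioc_of_le hS] at this
  · refine (ae_restrict_mem measurableSet_Ioc).mono fun s hs => ?_
    have := hs.1
    show 0 ≤ _
    positivity

lemma lintegral_Ioi_rpow {b S : ℝ} (hb : 0 < b) (hS : 0 < S) :
    ∫⁻ s in Set.Ioi S, ENNReal.ofReal (s ^ (-b - 1)) = ENNReal.ofReal (S ^ (-b) / b) := by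
  rw [← ofReal_integral_eq_lintegral_ofReal, integral_Ioi_rpow_of_lt (by linarith) hS]
  · congr 1; rw [sub_add_cancel]; field_simp
  · exact integrableOn_Ioi_rpow_of_lt (by linarith) hS
  · refine (ae_restrict_mem measurableSet_Ioi).mono fun s hs => ?_
    have : 0 < s := hS.trans hs
    show 0 ≤ _
    positivity

lemma lintegral_rpow_mul_le_split {a θ : ℝ} (ha : 0 < a) (hθ : 0 < θ) (hθ1 : θ < 1)
    {w : ℝ → ℝ≥0∞} (hw : Measurable w) {B : ℝ≥0∞} (hB : ∀ s, 0 < s → w s ≤ B) {S : ℝ} (hS : 0 < S) :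
    ∫⁻ s in Set.Ioi (0:ℝ), ENNReal.ofReal (s ^ (a * (1 - θ) / 2 - 1)) * w s ≤
      ENNReal.ofReal (S ^ (a * (1 - θ) / 2) / (a * (1 - θ) / 2)) * B +
        ENNReal.ofReal (S ^ (-(a * θ)) / (a * θ)) ^ (1 / 2 : ℝ) *
          (∫⁻ s in Set.Ioi (0:ℝ), ENNReal.ofReal (s ^ (a - 1)) * w s ^ 2) ^ (1 / 2 : ℝ) := by
  set c := a * (1 - θ) / 2 with hc
  have hc0 : 0 < c := by have : 0 < 1 - θ := by linarith
                         positivity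
  rw [← Set.Ioc_union_Ioi_eq_Ioi hS.le]
  refine (lintegral_union_le _ _ _).trans (add_le_add ?_ ?_)
  · rw [← lintegral_Ioc_rpow hc0 hS.le, ← lintegral_mul_const _ (by fun_prop)]
    refine setLIntegral_mono' measurableSet_Ioc fun s hs => ?_
    gcongr
    exact hB s hs.1
  · have h1 : ∀ s ∈ Set.Ioi S, ENNReal.ofReal (s ^ (c - 1)) * w s =
        ENNReal.ofReal (s ^ (-(a * θ) - 1)) ^ (1 / 2 : ℝ) *
          (ENNReal.ofReal (s ^ (a - 1)) * w s ^ 2) ^ (1 / 2 : ℝ) := by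
      intro s hs
      have hs0 : 0 < s := hS.trans hs
      rw [ENNReal.mul_rpow_of_nonneg _ _ (by norm_num), ← ENNReal.rpow_natCast (w s),
        ← ENNReal.rpow_mul, ENNReal.ofReal_rpow_of_pos (by positivity),
        ENNReal.ofReal_rpow_of_pos (by positivity), ← mul_assoc,
        ← ENNReal.ofReal_mul (by positivity), ← Real.rpow_mul hs0.le, ← Real.rpow_mul hs0.le,
        ← Real.rpow_add hs0]
      norm_num
      congr 3
      rw [hc]; ring
    rw [setLIntegral_congr_fun measurableSet_Ioi h1]
    have h2 := ENNReal.lintegral_mul_le_Lp_mul_Lq (volume.restrict (Set.Ioi S))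
      Real.HolderConjugate.two_two
      (f := fun s => ENNReal.ofReal (s ^ (-(a * θ) - 1)) ^ (1 / 2 : ℝ))
      (g := fun s => (ENNReal.ofReal (s ^ (a - 1)) * w s ^ 2) ^ (1 / 2 : ℝ)) (by fun_prop)
      (by fun_prop)
    refine h2.trans ?_
    simp_rw [← ENNReal.rpow_mul]
    norm_num only [ENNReal.rpow_one]
    rw [lintegral_Ioi_rpow (by positivity) hS]
    gcongr
    rw [Set.Ioc_union_Ioi_eq_Ioi hS.le]
    exact Set.Ioi_subset_Ioi hS.le

lemma lintegral_rpow_mul_le_interpolate {a θ : ℝ} (ha : 0 < a) (hθ : 0 < θ) (hθ1 : θ < 1) :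
    ∃ K : ℝ, 0 < K ∧ ∀ (w : ℝ → ℝ≥0∞) (_ : Measurable w) (B : ℝ≥0∞) (_ : B ≠ ∞)
      (_ : ∀ s, 0 < s → w s ≤ B),
    ∫⁻ s in Set.Ioi (0:ℝ), ENNReal.ofReal (s ^ (a * (1 - θ) / 2 - 1)) * w s ≤
      ENNReal.ofReal K * (B ^ θ *
        (∫⁻ s in Set.Ioi (0:ℝ), ENNReal.ofReal (s ^ (a - 1)) * w s ^ 2) ^ ((1 - θ) / 2)) := by
  have h1θ : 0 < 1 - θ := by linarith
  have hc0 : 0 < a * (1 - θ) / 2 := by positivity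
  have haθ : 0 < a * θ := by positivity
  refine ⟨1 / (a * (1 - θ) / 2) + (1 / (a * θ)) ^ (1 / 2 : ℝ), by positivity,
    fun w hw B hBtop hB => ?_⟩
  set K := 1 / (a * (1 - θ) / 2) + (1 / (a * θ)) ^ (1 / 2 : ℝ) with hK
  have hK0 : 0 < K := by positivity
  set G := ∫⁻ s in Set.Ioi (0:ℝ), ENNReal.ofReal (s ^ (a - 1)) * w s ^ 2 with hG
  have hzero : (∀ᵐ s ∂(volume.restrict (Set.Ioi (0:ℝ))), w s = 0) →
      ∫⁻ s in Set.Ioi (0:ℝ), ENNReal.ofReal (s ^ (a * (1 - θ) / 2 - 1)) * w s = 0 := by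
    intro h
    rw [lintegral_eq_zero_iff (by fun_prop)]
    filter_upwards [h] with s hs
    simp [hs]
  rcases eq_or_ne B 0 with hB0 | hB0
  · rw [hzero]
    · exact zero_le
    · refine (ae_restrict_mem measurableSet_Ioi).mono fun s hs => ?_
      exact le_antisymm ((hB s hs).trans hB0.le) zero_le
  rcases eq_or_ne G 0 with hG0 | hG0
  · rw [hzero]
    · exact zero_le
    · rw [hG, lintegral_eq_zero_iff (by fun_prop)] at hG0
      filter_upwards [hG0, ae_restrict_mem measurableSet_Ioi] with s hs hs0
      have hs0 : 0 < s := hs0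
      have : 0 < s ^ (a - 1) := by positivity
      simpa [this.not_ge] using hs
  rcases eq_or_ne G ∞ with hGt | hGt
  · rw [hGt, ENNReal.top_rpow_of_pos (by positivity), ENNReal.mul_top, ENNReal.mul_top]
    · exact le_top
    · simpa using hK0
    · simp [ENNReal.rpow_eq_zero_iff, hB0, hBtop]
  have hb : 0 < B.toReal := ENNReal.toReal_pos hB0 hBtop
  have hg : 0 < G.toReal := ENNReal.toReal_pos hG0 hGt
  have hSpos : 0 < (G.toReal / B.toReal ^ 2) ^ (1 / a) := by positivity
  refine (lintegral_rpow_mul_le_split ha hθ hθ1 hw hB hSpos).trans (le_of_eq ?_)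
  rw [← hG, ← ENNReal.ofReal_toReal hBtop, ← ENNReal.ofReal_toReal hGt,
    ENNReal.toReal_ofReal hb.le, ENNReal.toReal_ofReal hg.le]
  generalize B.toReal = b at *
  generalize G.toReal = g at *
  have e1 : ((g / b ^ 2) ^ (1 / a)) ^ (a * (1 - θ) / 2) * b = b ^ θ * g ^ ((1 - θ) / 2) := by
    rw [← Real.rpow_mul (by positivity), show 1 / a * (a * (1 - θ) / 2) = (1 - θ) / 2 by field_simp,
      Real.div_rpow hg.le (by positivity), ← Real.rpow_natCast, ← Real.rpow_mul hb.le,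
      div_mul_eq_mul_div, div_eq_mul_inv, ← Real.rpow_neg hb.le, mul_assoc, mul_comm]
    congr 1
    conv_lhs => enter [1]; rw [← Real.rpow_one b]
    rw [← Real.rpow_add hb]
    congr 1
    push_cast; ring
  have e2 : (((g / b ^ 2) ^ (1 / a)) ^ (-(a * θ))) ^ (1 / 2 : ℝ) * g ^ (1 / 2 : ℝ) =
      b ^ θ * g ^ ((1 - θ) / 2) := by
    rw [← Real.rpow_mul (by positivity), ← Real.rpow_mul (by positivity),
      show 1 / a * (-(a * θ) * (1 / 2)) = -(θ / 2) by field_simp,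
      Real.div_rpow hg.le (by positivity), ← Real.rpow_natCast b, ← Real.rpow_mul hb.le,
      div_mul_eq_mul_div, div_eq_mul_inv, ← Real.rpow_neg hb.le, ← Real.rpow_add hg, mul_comm]
    congr 1 <;> congr 1 <;> push_cast <;> ring
  rw [ENNReal.ofReal_rpow_of_pos (by positivity), ENNReal.ofReal_rpow_of_pos (by positivity),
    ENNReal.ofReal_rpow_of_pos (by positivity), ENNReal.ofReal_rpow_of_pos (by positivity),
    ← ENNReal.ofReal_mul (by positivity), ← ENNReal.ofReal_mul (by positivity),
    ← ENNReal.ofReal_mul (by positivity), ← ENNReal.ofReal_mul (by positivity),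
    ← ENNReal.ofReal_add (by positivity) (by positivity)]
  congr 1
  rw [div_eq_mul_one_div (_ ^ (-(a * θ))), Real.mul_rpow (by positivity) (by positivity),
    div_eq_mul_one_div (_ ^ (a * (1 - θ) / 2)), hK]
  linear_combination (1 / (a * (1 - θ) / 2)) * e1 + (1 / (a * θ)) ^ (1 / 2 : ℝ) * e2

/-- A Gagliardo–Nirenberg inequality between `L²` and a sup bound on `a` derivatives. -/
lemma lintegral_osc_rpow_le {a θ : ℝ} (ha : 0 < a) (hθ : 0 < θ) (hθ1 : θ < 1) :
    ∃ K : ℝ, 0 < K ∧ ∀ (f : ℝ → ℂ) (_ : Measurable f) (_ : Integrable f)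
      (_ : Integrable fun ξ => ((|ξ| ^ a : ℝ) : ℂ) * f ξ) (B : ℝ≥0∞) (_ : B ≠ ∞)
      (_ : ∀ x, ‖osc (fun ξ => ((|ξ| ^ a : ℝ) : ℂ) * f ξ) x‖ₑ ≤ B),
    ∫⁻ x, ‖osc (fun ξ => ((|ξ| ^ (θ * a) : ℝ) : ℂ) * f ξ) x‖ₑ ^ (2 / (1 - θ)) ≤
      ENNReal.ofReal K * B ^ (2 * θ / (1 - θ)) * ∫⁻ ξ, ‖f ξ‖ₑ ^ 2 := by
  have h1θ : 0 < 1 - θ := by linarith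
  obtain ⟨K, hK0, hK⟩ := lintegral_rpow_mul_le_interpolate ha hθ hθ1
  have hΓ : 0 < Real.Gamma (a * (1 - θ) / 2) := Real.Gamma_pos_of_pos (by positivity)
  have hΓa : 0 < Real.Gamma a := Real.Gamma_pos_of_pos ha
  set γ := Real.Gamma (a * (1 - θ) / 2) with hγ
  refine ⟨(K / γ) ^ (2 / (1 - θ)) * (2 * Real.pi * Real.Gamma a), by positivity,
    fun f hfm hf hfa B hBt hB => ?_⟩
  set G : ℝ → ℝ≥0∞ := fun x =>
    ∫⁻ s in Set.Ioi (0:ℝ), ENNReal.ofReal (s ^ (a - 1)) * ‖heatOsc a f s x‖ₑ ^ 2 with hG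
  have hW := measurable_heatOsc (a := a) hfm
  have hbd : ∀ s x, 0 < s → ‖heatOsc a f s x‖ₑ ≤ B := by
    intro s x hs
    have h1 : ∀ x, ‖osc (fun ξ => ((|ξ| ^ a : ℝ) : ℂ) * f ξ) x‖ ≤ B.toReal := fun x => by
      rw [← toReal_enorm]
      exact ENNReal.toReal_mono hBt (hB x)
    have h2 := norm_osc_gaussian_mul_le hfa h1 hs x
    rw [← ofReal_norm]
    exact ENNReal.ofReal_le_of_le_toReal h2
  have hpt : ∀ x, ‖osc (fun ξ => ((|ξ| ^ (θ * a) : ℝ) : ℂ) * f ξ) x‖ₑ ^ (2 / (1 - θ)) ≤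
      ENNReal.ofReal ((K / γ) ^ (2 / (1 - θ))) * B ^ (2 * θ / (1 - θ)) * G x := by
    intro x
    have h1 := ofReal_Gamma_mul_enorm_osc_le ha hθ hθ1 hfm hf hfa x
    have hwm : Measurable fun s => ‖heatOsc a f s x‖ₑ :=
      (hW.comp (measurable_id.prodMk measurable_const)).enorm
    have h2 : ENNReal.ofReal γ * _ ≤ ENNReal.ofReal K * (B ^ θ * G x ^ ((1 - θ) / 2)) :=
      h1.trans (hK (fun s => ‖heatOsc a f s x‖ₑ) hwm B hBt fun s hs => hbd s x hs)
    have h3 : ‖osc (fun ξ => ((|ξ| ^ (θ * a) : ℝ) : ℂ) * f ξ) x‖ₑ ≤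
        ENNReal.ofReal (K / γ) * (B ^ θ * G x ^ ((1 - θ) / 2)) := by
      rw [mul_comm, ← ENNReal.le_div_iff_mul_le (Or.inl (by simpa using hΓ)) (Or.inl (by simp))] at h2
      rw [ENNReal.ofReal_div_of_pos hΓ]
      rwa [ENNReal.mul_div_right_comm] at h2
    calc _ ≤ (ENNReal.ofReal (K / γ) * (B ^ θ * G x ^ ((1 - θ) / 2))) ^ (2 / (1 - θ)) := by gcongr
      _ = _ := by
        rw [ENNReal.mul_rpow_of_nonneg _ _ (by positivity),
          ENNReal.mul_rpow_of_nonneg _ _ (by positivity), ← ENNReal.rpow_mul, ← ENNReal.rpow_mul,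
          ENNReal.ofReal_rpow_of_pos (by positivity), ← mul_assoc,
          show (1 - θ) / 2 * (2 / (1 - θ)) = 1 by field_simp, ENNReal.rpow_one,
          show θ * (2 / (1 - θ)) = 2 * θ / (1 - θ) by ring]
  refine (lintegral_mono hpt).trans ?_
  rw [lintegral_const_mul' _ _ (ENNReal.mul_ne_top ENNReal.ofReal_ne_top
    (ENNReal.rpow_ne_top_of_nonneg (by positivity) hBt))]
  refine (mul_le_mul_right (lintegral_heatOsc_square_function_le ha hfm hfa) _).trans (le_of_eq ?_)
  rw [ENNReal.ofReal_mul (p := (K / γ) ^ (2 / (1 - θ))) (by positivity),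
    ENNReal.ofReal_mul (p := 2 * Real.pi) (by positivity)]
  ring

lemma exists_lintegral_dual_le {α : ℝ} (h0 : 0 ≤ α) (h1 : α ≤ 1) :
    ∃ K : ℝ, 0 < K ∧ ∀ (y : ℝ → ℝ) (_ : Measurable y) (h : ℝ → ℂ) (_ : Measurable h)
      (_ : Integrable h),
    ∫⁻ ξ : ℝ, ENNReal.ofReal (|ξ| ^ α) * ‖∫ t, cexp (I * (y t * ξ + t * ξ ^ 4 : ℝ)) * h t‖ₑ ^ 2 ≤
      ENNReal.ofReal K * (∫⁻ t, ‖h t‖ₑ ^ (2 / (2 - (1 + α) / 4))) ^ (2 - (1 + α) / 4) := by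
  set γ := (1 + α) / 4 with hγ
  have hγ0 : 0 < γ := by positivity
  have hγ1 : γ < 1 := by linarith
  have : 0 < 1 - γ := by linarith
  refine ⟨14 * (2 * (2 / (1 - γ) + 2 ^ (γ / 2))), by positivity, fun y hy h hm hh => ?_⟩
  set φ : ℝ → ℝ → ℝ := fun ξ t => y t * ξ + t * ξ ^ 4 with hφ
  have hφm : Measurable (Function.uncurry φ) := by
    simp only [hφ, Function.uncurry_def]; fun_prop
  have hTc : Continuous fun ξ => ∫ t, cexp (I * (φ ξ t : ℝ)) * h t :=
    continuous_integral_cexp (fun t => by simp only [hφ]; fun_prop)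
      (fun ξ => by simp only [hφ]; fun_prop) hh
  have hTm := hTc.measurable
  have htrunc : ∀ R : ℕ, ∫⁻ ξ in Set.Ioc (-(R : ℝ)) R, ENNReal.ofReal (|ξ| ^ α) *
      ‖∫ t, cexp (I * (φ ξ t : ℝ)) * h t‖ₑ ^ 2 ≤ ENNReal.ofReal (14 * (2 * (2 / (1 - γ) + 2 ^ (γ / 2)))) *
        (∫⁻ t, ‖h t‖ₑ ^ (2 / (2 - γ))) ^ (2 - γ) := by
    intro R
    have hR : (0:ℝ) ≤ R := Nat.cast_nonneg R
    set m : ℝ → ℝ := (Set.Ioc (-(R : ℝ)) R).indicator fun ξ => |ξ| ^ α with hmdef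
    have hmi : Integrable m := by
      rw [hmdef, integrable_indicator_iff measurableSet_Ioc]
      have : Continuous fun ξ : ℝ => |ξ| ^ α := continuous_abs.rpow_const fun _ => Or.inr h0
      exact (this.integrableOn_Icc (a := -(R:ℝ)) (b := R)).mono_set Set.Ioc_subset_Icc_self
    have hm0 : ∀ x, 0 ≤ m x := Set.indicator_nonneg fun ξ _ => by positivity
    have e1 : ∀ t s : ℝ, ∫ ξ, (m ξ : ℂ) * cexp (I * (φ ξ t - φ ξ s)) =
        ∫ ξ in (-(R:ℝ))..R, ((|ξ| ^ α : ℝ) : ℂ) * cexp (I * ((y t - y s : ℝ) * ξ + (t - s : ℝ) * ξ ^ 4)) := by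
      intro t s
      rw [intervalIntegral.integral_of_le (by linarith), ← integral_indicator measurableSet_Ioc]
      refine integral_congr_ae (Filter.Eventually.of_forall fun ξ => ?_)
      by_cases hξ : ξ ∈ Set.Ioc (-(R:ℝ)) R
      · simp only [hmdef, Set.indicator_of_mem hξ, hφ]
        congr 3
        push_cast; ring
      · simp [hmdef, Set.indicator_of_notMem hξ]
    calc ∫⁻ ξ in Set.Ioc (-(R : ℝ)) R, ENNReal.ofReal (|ξ| ^ α) *
          ‖∫ t, cexp (I * (φ ξ t : ℝ)) * h t‖ₑ ^ 2
        = ∫⁻ ξ, ENNReal.ofReal (m ξ) * ‖∫ t, cexp (I * (φ ξ t : ℝ)) * h t‖ₑ ^ 2 := by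
          rw [← lintegral_indicator measurableSet_Ioc]
          refine lintegral_congr fun ξ => ?_
          by_cases hξ : ξ ∈ Set.Ioc (-(R:ℝ)) R
          · simp only [hmdef, Set.indicator_of_mem hξ]
          · simp [hmdef, Set.indicator_of_notMem hξ]
      _ ≤ _ := lintegral_mul_norm_sq_oscillatory_le hmi hm0 hφm hh
      _ ≤ ∫⁻ t, ∫⁻ s, ENNReal.ofReal 14 * (‖h t‖ₑ * ‖h s‖ₑ * ENNReal.ofReal (|t - s| ^ (-γ))) := by
          refine lintegral_mono fun t => lintegral_mono_ae ?_
          have : ∀ᵐ s : ℝ, s ≠ t := by simp [ae_iff, measure_singleton]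
          filter_upwards [this] with s hs
          rw [e1, mul_left_comm]
          refine mul_le_mul_right ?_ _
          rw [← ENNReal.ofReal_mul (by norm_num), ← ofReal_norm]
          exact ENNReal.ofReal_le_ofReal
            (norm_kernel_le h0 h1 (sub_ne_zero.mpr hs.symm) (y t - y s) hR)
      _ = ENNReal.ofReal 14 * ∫⁻ t, ∫⁻ s, ‖h t‖ₑ * ‖h s‖ₑ * ENNReal.ofReal (|t - s| ^ (-γ)) := by
          simp_rw [lintegral_const_mul' _ _ ENNReal.ofReal_ne_top]
      _ ≤ _ := by
          rw [ENNReal.ofReal_mul (by norm_num), mul_assoc]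
          refine mul_le_mul_right ?_ _
          exact lintegral_riesz_le hγ0 hγ1 hm.enorm fun t => enorm_ne_top
  have hcov : AECover volume Filter.atTop fun R : ℕ => Set.Ioc (-(R : ℝ)) R :=
    aecover_Ioc (Filter.tendsto_neg_atTop_atBot.comp tendsto_natCast_atTop_atTop)
      tendsto_natCast_atTop_atTop
  exact le_of_tendsto' (hcov.lintegral_tendsto_of_countably_generated (by fun_prop)) htrunc

/-- The space-time extension `(t, x) ↦ ∫ e^{i(xξ+tξ⁴)} g(ξ) dξ`. -/
noncomputable def disp (g : ℝ → ℂ) (t x : ℝ) : ℂ :=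
  ∫ ξ : ℝ, cexp (I * (x * ξ + t * ξ ^ 4 : ℝ)) * g ξ

lemma continuous_disp {g : ℝ → ℂ} (hg : Integrable g) : Continuous (Function.uncurry (disp g)) :=
  continuous_integral_cexp (X := ℝ × ℝ) (φ := fun z ξ => z.2 * ξ + z.1 * ξ ^ 4)
    (fun ξ => by fun_prop) (fun z => by fun_prop) hg

lemma norm_disp_le (g : ℝ → ℂ) (t x : ℝ) : ‖disp g t x‖ ≤ ∫ ξ, ‖g ξ‖ := by
  refine (norm_integral_le_integral_norm _).trans (le_of_eq ?_)
  simp_rw [norm_mul, norm_cexp_I_mul_ofReal, one_mul]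

lemma exists_enorm_integral_mul_disp_le {α : ℝ} (h0 : 0 ≤ α) (h1 : α ≤ 1) :
    ∃ K : ℝ, 0 < K ∧ ∀ (f : ℝ → ℂ) (_ : Measurable f)
      (_ : Integrable fun ξ => ((|ξ| ^ (α / 2) : ℝ) : ℂ) * f ξ)
      (y : ℝ → ℝ) (_ : Measurable y) (h : ℝ → ℂ) (_ : Measurable h) (_ : Integrable h),
    ‖∫ t, h t * disp (fun ξ => ((|ξ| ^ (α / 2) : ℝ) : ℂ) * f ξ) t (y t)‖ₑ ≤
      (ENNReal.ofReal K * ∫⁻ ξ, ‖f ξ‖ₑ ^ 2) ^ (1 / 2 : ℝ) *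
        (∫⁻ t, ‖h t‖ₑ ^ (2 / (2 - (1 + α) / 4))) ^ ((2 - (1 + α) / 4) / 2) := by
  obtain ⟨K, hK0, hK⟩ := exists_lintegral_dual_le h0 h1
  refine ⟨K, hK0, fun f hf hg y hy h hm hh => ?_⟩
  set T : ℝ → ℂ := fun ξ => ∫ t, cexp (I * (y t * ξ + t * ξ ^ 4 : ℝ)) * h t with hT
  have hTm : Measurable T := (continuous_integral_cexp (φ := fun ξ t => y t * ξ + t * ξ ^ 4)
    (fun t => by fun_prop) (fun ξ => by fun_prop) hh).measurable
  have e1 : ∫ t, h t * disp (fun ξ => ((|ξ| ^ (α / 2) : ℝ) : ℂ) * f ξ) t (y t) =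
      ∫ ξ, (((|ξ| ^ (α / 2) : ℝ) : ℂ) * f ξ) * T ξ := by
    simp only [disp, hT, ← integral_const_mul]
    rw [integral_integral_swap]
    · refine integral_congr_ae (Filter.Eventually.of_forall fun ξ =>
        integral_congr_ae (Filter.Eventually.of_forall fun t => ?_))
      simp only; ring
    · refine ((hh.mul_prod hg).bdd_mul (c := 1)
        (f := fun z : ℝ × ℝ => cexp (I * (y z.1 * z.2 + z.1 * z.2 ^ 4 : ℝ)))
        (Measurable.aestronglyMeasurable (by fun_prop))
        (Filter.Eventually.of_forall fun z => (norm_cexp_I_mul_ofReal _).le)).congr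
        (Filter.Eventually.of_forall fun z => ?_)
      simp only [Function.uncurry]
      ring
  rw [e1]
  have h2 := ENNReal.lintegral_mul_le_Lp_mul_Lq volume Real.HolderConjugate.two_two
    (f := fun ξ => ‖f ξ‖ₑ) (g := fun ξ => ENNReal.ofReal (|ξ| ^ (α / 2)) * ‖T ξ‖ₑ) (by fun_prop)
    (by fun_prop)
  have e2 : ∀ ξ : ℝ, (ENNReal.ofReal (|ξ| ^ (α / 2)) * ‖T ξ‖ₑ) ^ (2 : ℝ) =
      ENNReal.ofReal (|ξ| ^ α) * ‖T ξ‖ₑ ^ 2 := fun ξ => by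
    rw [ENNReal.rpow_two, mul_pow, ← ENNReal.ofReal_pow (by positivity), ← Real.rpow_natCast,
      ← Real.rpow_mul (abs_nonneg ξ)]
    congr 3
    push_cast; ring
  calc _ ≤ ∫⁻ ξ, ‖(((|ξ| ^ (α / 2) : ℝ) : ℂ) * f ξ) * T ξ‖ₑ := enorm_integral_le_lintegral_enorm _
    _ = ∫⁻ ξ, ‖f ξ‖ₑ * (ENNReal.ofReal (|ξ| ^ (α / 2)) * ‖T ξ‖ₑ) := by
      refine lintegral_congr fun ξ => ?_
      rw [enorm_mul, enorm_mul, ← ofReal_norm ((_ : ℝ) : ℂ), norm_real,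
        Real.norm_of_nonneg (by positivity)]
      ring
    _ ≤ _ := h2
    _ ≤ (∫⁻ ξ, ‖f ξ‖ₑ ^ 2) ^ (1 / 2 : ℝ) *
        (ENNReal.ofReal K * (∫⁻ t, ‖h t‖ₑ ^ (2 / (2 - (1 + α) / 4))) ^ (2 - (1 + α) / 4)) ^
          (1 / 2 : ℝ) := by
      simp_rw [e2, ENNReal.rpow_two]
      gcongr
      exact hK y hy h hm hh
    _ = _ := by
      rw [ENNReal.mul_rpow_of_nonneg _ _ (by norm_num), ENNReal.mul_rpow_of_nonneg _ _ (by norm_num),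
        ← ENNReal.rpow_mul, mul_one_div]
      ring

lemma exists_lintegral_disp_rpow_le {α : ℝ} (h0 : 0 ≤ α) (h1 : α ≤ 1) :
    ∃ K : ℝ, 0 < K ∧ ∀ (f : ℝ → ℂ) (_ : Measurable f)
      (_ : Integrable fun ξ => ((|ξ| ^ (α / 2) : ℝ) : ℂ) * f ξ) (y : ℝ → ℝ) (_ : Measurable y),
    ∫⁻ t, ‖disp (fun ξ => ((|ξ| ^ (α / 2) : ℝ) : ℂ) * f ξ) t (y t)‖ₑ ^ (8 / (1 + α)) ≤
      (ENNReal.ofReal K * ∫⁻ ξ, ‖f ξ‖ₑ ^ 2) ^ (4 / (1 + α)) := by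
  obtain ⟨K, hK0, hK⟩ := exists_enorm_integral_mul_disp_le h0 h1
  refine ⟨K, hK0, fun f hf hg y hy => ?_⟩
  set q := 8 / (1 + α) with hq
  have hq4 : 4 ≤ q := by rw [hq, le_div_iff₀ (by linarith)]; linarith
  have hγq : (1 + α) / 4 = 2 / q := by rw [hq]; field_simp; norm_num
  rw [hγq] at hK
  have hq2 : 4 / (1 + α) = q / 2 := by rw [hq]; field_simp; norm_num
  rw [hq2]
  set V : ℝ → ℂ := fun t => disp (fun ξ => ((|ξ| ^ (α / 2) : ℝ) : ℂ) * f ξ) t (y t) with hV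
  have hVm : Measurable V := (continuous_disp hg).measurable.comp (measurable_id.prodMk hy)
  set M := ∫ ξ, ‖((|ξ| ^ (α / 2) : ℝ) : ℂ) * f ξ‖ with hM
  have hVM : ∀ t, ‖V t‖ ≤ M := fun t => norm_disp_le _ _ _
  have htrunc : ∀ R : ℕ, ∫⁻ t in Set.Ioc (-(R : ℝ)) R, ‖V t‖ₑ ^ q ≤
      (ENNReal.ofReal K * ∫⁻ ξ, ‖f ξ‖ₑ ^ 2) ^ (q / 2) := by
    intro R
    set E := Set.Ioc (-(R : ℝ)) R with hE
    have hEfin : volume E < ∞ := by simp [hE]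
    set h : ℝ → ℂ := E.indicator fun t => (starRingEnd ℂ) (V t) * ((‖V t‖ ^ (q - 2) : ℝ) : ℂ) with hh
    have hhm : Measurable h := by
      refine Measurable.indicator ?_ measurableSet_Ioc
      have : Measurable fun t => (starRingEnd ℂ) (V t) := Complex.continuous_conj.measurable.comp hVm
      fun_prop
    have hhn : ∀ t ∈ E, ‖h t‖ₑ = ‖V t‖ₑ ^ (q - 1) := by
      intro t ht
      rw [hh, Set.indicator_of_mem ht, enorm_mul, ← ofReal_norm, ← ofReal_norm, RCLike.norm_conj,
        norm_real, Real.norm_of_nonneg (by positivity), ← ENNReal.ofReal_mul (norm_nonneg _),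
        ← ofReal_norm, ENNReal.ofReal_rpow_of_nonneg (norm_nonneg _) (by linarith)]
      congr 1
      rcases eq_or_ne (V t) 0 with h | h
      · simp [h, Real.zero_rpow (show q - 1 ≠ 0 by linarith)]
      · rw [mul_comm, ← Real.rpow_add_one (by simpa using h)]
        congr 1; ring
    have hhi : Integrable h := by
      rw [hh, integrable_indicator_iff measurableSet_Ioc]
      refine Measure.integrableOn_of_bounded (M := M * M ^ (q - 2)) hEfin.ne ?_ ?_
      · have : Measurable fun t => (starRingEnd ℂ) (V t) :=
          Complex.continuous_conj.measurable.comp hVm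
        exact Measurable.aestronglyMeasurable (by fun_prop)
      · refine Filter.Eventually.of_forall fun t => ?_
        rw [norm_mul, RCLike.norm_conj, norm_real, Real.norm_of_nonneg (by positivity)]
        have := hVM t
        have h3 : 0 ≤ M := (norm_nonneg _).trans this
        have := Real.rpow_le_rpow (norm_nonneg _) this (show 0 ≤ q - 2 by linarith)
        gcongr
    set J := ∫⁻ t in E, ‖V t‖ₑ ^ q with hJ
    have hJt : J ≠ ∞ := by
      refine ((setLIntegral_mono' measurableSet_Ioc (g := fun _ => ENNReal.ofReal M ^ q)
        fun t _ => ?_).trans_lt ?_).ne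
      · rw [← ofReal_norm]
        gcongr
        exact hVM t
      · rw [setLIntegral_const]
        exact ENNReal.mul_lt_top (ENNReal.rpow_lt_top_of_nonneg (by linarith) (by simp)) hEfin
    have hJ2 : ∫⁻ t, ‖h t‖ₑ ^ (2 / (2 - 2 / q)) = J := by
      rw [hJ, ← lintegral_indicator measurableSet_Ioc]
      refine lintegral_congr fun t => ?_
      have hpos : 0 < 2 / (2 - 2 / q) := by
        have : 2 / q ≤ 2 / 4 := by gcongr
        apply div_pos <;> linarith
      by_cases ht : t ∈ E
      · rw [hhn t ht, Set.indicator_of_mem ht, ← ENNReal.rpow_mul]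
        congr 1
        have : q - 1 ≠ 0 := by linarith
        field_simp
      · rw [hh, Set.indicator_of_notMem ht, Set.indicator_of_notMem ht, enorm_zero,
          ENNReal.zero_rpow_of_pos hpos]
    have hJ1 : ‖∫ t, h t * V t‖ₑ = J := by
      have e3 : ∀ t, h t * V t = ((E.indicator (fun t => ‖V t‖ ^ q) t : ℝ) : ℂ) := by
        intro t
        by_cases ht : t ∈ E
        · rw [hh, Set.indicator_of_mem ht, Set.indicator_of_mem ht, mul_right_comm, mul_comm _ (V t),
            Complex.mul_conj, ← ofReal_mul, Complex.normSq_eq_norm_sq]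
          congr 1
          rcases eq_or_ne (V t) 0 with h | h
          · simp [h, Real.zero_rpow (show q ≠ 0 by linarith)]
          · rw [← Real.rpow_natCast, ← Real.rpow_add (by simpa using h)]
            congr 1; push_cast; ring
        · simp [hh, Set.indicator_of_notMem ht]
      simp_rw [e3]
      rw [integral_complex_ofReal, integral_indicator measurableSet_Ioc, ← ofReal_norm, norm_real,
        Real.norm_of_nonneg (integral_nonneg fun t => by positivity),
        integral_eq_lintegral_of_nonneg_ae (Filter.Eventually.of_forall fun t => by positivity)
          (Measurable.aestronglyMeasurable (by fun_prop))]
      have e4 : ∀ t, ENNReal.ofReal (‖V t‖ ^ q) = ‖V t‖ₑ ^ q := fun t => by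
        rw [← ofReal_norm, ENNReal.ofReal_rpow_of_nonneg (norm_nonneg _) (by linarith)]
      simp_rw [e4]
      exact ENNReal.ofReal_toReal hJt
    have h5 := hK f hf hg y hy h hhm hhi
    rw [hJ2] at h5
    have h6 : J ≤ (ENNReal.ofReal K * ∫⁻ ξ, ‖f ξ‖ₑ ^ 2) ^ (1 / 2 : ℝ) * J ^ ((2 - 2 / q) / 2) :=
      hJ1 ▸ h5
    rcases eq_or_ne J 0 with hJ0 | hJ0
    · rw [hJ0]; exact zero_le
    have h7 : J ^ (1 / q) ≤ (ENNReal.ofReal K * ∫⁻ ξ, ‖f ξ‖ₑ ^ 2) ^ (1 / 2 : ℝ) := by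
      have e5 : J ^ (1 / q) * J ^ ((2 - 2 / q) / 2) = J := by
        rw [← ENNReal.rpow_add _ _ hJ0 hJt]
        conv_rhs => rw [← ENNReal.rpow_one J]
        congr 1
        field_simp; ring
      conv_lhs at h6 => rw [← e5]
      exact (ENNReal.mul_le_mul_iff_left (by simp [ENNReal.rpow_eq_zero_iff, hJ0, hJt])
        (by simp [ENNReal.rpow_eq_top_iff, hJ0, hJt])).mp h6
    calc J = (J ^ (1 / q)) ^ q := by
          rw [← ENNReal.rpow_mul, one_div, inv_mul_cancel₀ (by linarith), ENNReal.rpow_one]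
      _ ≤ ((ENNReal.ofReal K * ∫⁻ ξ, ‖f ξ‖ₑ ^ 2) ^ (1 / 2 : ℝ)) ^ q := by gcongr
      _ = _ := by rw [← ENNReal.rpow_mul]; congr 1; ring
  have hcov : AECover volume Filter.atTop fun R : ℕ => Set.Ioc (-(R : ℝ)) R :=
    aecover_Ioc (Filter.tendsto_neg_atTop_atBot.comp tendsto_natCast_atTop_atTop)
      tendsto_natCast_atTop_atTop
  exact le_of_tendsto' (hcov.lintegral_tendsto_of_countably_generated
    (hVm.enorm.pow_const q).aemeasurable) htrunc

/-- For a jointly continuous function, a bound on `∫ |F(t, y(t))|^q dt` uniform over measurable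
choices `y` bounds the integral of the supremum. -/
lemma lintegral_iSup_enorm_rpow_le {F : ℝ → ℝ → ℂ} (hF : Continuous (Function.uncurry F)) {q : ℝ}
    (hq : 0 < q) {A : ℝ≥0∞} (hA : ∀ y : ℝ → ℝ, Measurable y → ∫⁻ t, ‖F t (y t)‖ₑ ^ q ≤ A) :
    ∫⁻ t, (⨆ x, ‖F t x‖ₑ) ^ q ≤ A := by
  set d : ℕ → ℝ := TopologicalSpace.denseSeq ℝ
  let Y : ℕ → ℝ → ℝ := fun N => Nat.rec (fun _ => d 0)
    (fun n y t => if ‖F t (y t)‖ ≤ ‖F t (d (n + 1))‖ then d (n + 1) else y t) N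
  have hY : ∀ n t, Y (n + 1) t = if ‖F t (Y n t)‖ ≤ ‖F t (d (n + 1))‖ then d (n + 1) else Y n t :=
    fun n t => rfl
  have hcomp : ∀ {y : ℝ → ℝ}, Measurable y → Measurable fun t => F t (y t) := fun hy =>
    hF.measurable.comp (measurable_id.prodMk hy)
  have hYm : ∀ n, Measurable (Y n) := by
    intro n
    induction n with
    | zero => exact measurable_const
    | succ n ih =>
      exact Measurable.ite (measurableSet_le (hcomp ih).norm (hcomp measurable_const).norm)
        measurable_const ih
  have hYle : ∀ n t, ‖F t (Y n t)‖ ≤ ‖F t (Y (n + 1) t)‖ ∧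
      ‖F t (d (n + 1))‖ ≤ ‖F t (Y (n + 1) t)‖ := by
    intro n t
    rw [hY]
    split_ifs with h
    · exact ⟨h, le_rfl⟩
    · exact ⟨le_rfl, (not_le.mp h).le⟩
  have henorm : ∀ {a b : ℂ}, ‖a‖ ≤ ‖b‖ → ‖a‖ₑ ≤ ‖b‖ₑ := fun h => by
    rw [← ofReal_norm, ← ofReal_norm]; exact ENNReal.ofReal_le_ofReal h
  have hsup : ∀ t, ⨆ x, ‖F t x‖ₑ ≤ ⨆ n, ‖F t (Y n t)‖ₑ := by
    intro t
    have hclosed : IsClosed {x | ‖F t x‖ₑ ≤ ⨆ n, ‖F t (Y n t)‖ₑ} := by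
      have : Continuous (F t) := hF.comp (continuous_const.prodMk continuous_id)
      exact isClosed_le this.enorm continuous_const
    have hsub : Set.range d ⊆ {x | ‖F t x‖ₑ ≤ ⨆ n, ‖F t (Y n t)‖ₑ} := by
      rintro _ ⟨n, rfl⟩
      refine le_trans ?_ (le_iSup (fun n => ‖F t (Y n t)‖ₑ) n)
      cases n with
      | zero => exact le_rfl
      | succ n => exact henorm (hYle n t).2
    have hall := hclosed.closure_subset_iff.mpr hsub
    rw [(TopologicalSpace.denseRange_denseSeq ℝ).closure_range] at hall
    exact iSup_le fun x => hall (Set.mem_univ x)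
  calc ∫⁻ t, (⨆ x, ‖F t x‖ₑ) ^ q ≤ ∫⁻ t, ⨆ n, ‖F t (Y n t)‖ₑ ^ q := by
        refine lintegral_mono fun t => ?_
        refine (ENNReal.rpow_le_rpow (hsup t) hq.le).trans (le_of_eq ?_)
        exact OrderIso.map_iSup (ENNReal.orderIsoRpow q hq) fun n => ‖F t (Y n t)‖ₑ
    _ = ⨆ n, ∫⁻ t, ‖F t (Y n t)‖ₑ ^ q := by
        refine lintegral_iSup (fun n => (hcomp (hYm n)).enorm.pow_const _) ?_
        refine monotone_nat_of_le_succ fun n t => ?_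
        exact ENNReal.rpow_le_rpow (henorm (hYle n t).1) hq.le
    _ ≤ A := iSup_le fun n => hA _ (hYm n)

lemma exists_lintegral_osc_rpow_le {a θ : ℝ} (ha : 0 ≤ a) (hθ : 0 < θ) (hθ1 : θ < 1) :
    ∃ K : ℝ, 0 < K ∧ ∀ (f : ℝ → ℂ) (_ : Measurable f) (_ : Integrable f)
      (_ : Integrable fun ξ => ((|ξ| ^ a : ℝ) : ℂ) * f ξ) (B : ℝ≥0∞) (_ : B ≠ ∞)
      (_ : ∀ x, ‖osc (fun ξ => ((|ξ| ^ a : ℝ) : ℂ) * f ξ) x‖ₑ ≤ B),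
    ∫⁻ x, ‖osc (fun ξ => ((|ξ| ^ (θ * a) : ℝ) : ℂ) * f ξ) x‖ₑ ^ (2 / (1 - θ)) ≤
      ENNReal.ofReal K * B ^ (2 * θ / (1 - θ)) * ∫⁻ ξ, ‖f ξ‖ₑ ^ 2 := by
  rcases ha.eq_or_lt with rfl | ha
  · have h1θ : 0 < 1 - θ := by linarith
    refine ⟨2 * Real.pi, by positivity, fun f hfm hf _ B hBt hB => ?_⟩
    simp only [mul_zero, Real.rpow_zero, ofReal_one, one_mul] at hB ⊢
    calc ∫⁻ x, ‖osc f x‖ₑ ^ (2 / (1 - θ))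
        ≤ ∫⁻ x, B ^ (2 * θ / (1 - θ)) * ‖osc f x‖ₑ ^ 2 := by
          refine lintegral_mono fun x => ?_
          rw [show 2 / (1 - θ) = 2 * θ / (1 - θ) + 2 by field_simp; ring,
            ENNReal.rpow_add_of_nonneg _ _ (by positivity) (by norm_num), ENNReal.rpow_two]
          gcongr
          exact hB x
      _ ≤ B ^ (2 * θ / (1 - θ)) * (ENNReal.ofReal (2 * Real.pi) * ∫⁻ ξ, ‖f ξ‖ₑ ^ 2) := by
          rw [lintegral_const_mul' _ _ (ENNReal.rpow_ne_top_of_nonneg (by positivity) hBt)]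
          gcongr
          exact lintegral_osc_sq_le hf
      _ = _ := by ring
  · exact lintegral_osc_rpow_le ha hθ hθ1

lemma fourierInt_eq_fourier (u : SchwartzMap ℝ ℂ) (ξ : ℝ) :
    fourierInt (fun y => u y) ξ = FourierTransform.fourier u (ξ / (2 * Real.pi)) := by
  rw [SchwartzMap.fourier_coe, Real.fourier_real_eq_integral_exp_smul, fourierInt]
  refine integral_congr_ae (Filter.Eventually.of_forall fun x => ?_)
  simp only [smul_eq_mul]
  congr 2
  have : (Real.pi : ℂ) ≠ 0 := by exact_mod_cast Real.pi_ne_zero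
  push_cast
  field_simp

lemma continuous_fourierInt (u : SchwartzMap ℝ ℂ) : Continuous (fourierInt fun y => u y) := by
  simp_rw [funext (fourierInt_eq_fourier u)]
  exact (FourierTransform.fourier u).continuous.comp (by fun_prop)

lemma integrable_rpow_mul_fourierInt (u : SchwartzMap ℝ ℂ) {β : ℝ} (h0 : 0 ≤ β) (h1 : β ≤ 1) :
    Integrable fun ξ : ℝ => ((|ξ| ^ β : ℝ) : ℂ) * fourierInt (fun y => u y) ξ := by
  set g := FourierTransform.fourier u with hg
  have hw := continuous_fourierInt u
  have h2 : Integrable fun ξ : ℝ => (2 * Real.pi) *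
      (|ξ / (2 * Real.pi)| ^ 1 * ‖g (ξ / (2 * Real.pi))‖) := by
    refine Integrable.const_mul ?_ _
    exact (g.integrable_pow_mul volume 1).comp_div (by positivity)
  have h3 : Integrable fun ξ : ℝ => ‖g (ξ / (2 * Real.pi))‖ :=
    g.integrable.norm.comp_div (by positivity)
  refine (h3.add h2).mono' (Measurable.aestronglyMeasurable (by fun_prop))
    (Filter.Eventually.of_forall fun ξ => ?_)
  rw [fourierInt_eq_fourier, norm_mul, norm_real, Real.norm_of_nonneg (by positivity),
    Pi.add_apply, abs_div, abs_of_pos (show 0 < 2 * Real.pi by positivity)]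
  have h4 : |ξ| ^ β ≤ 1 + |ξ| := by
    rcases le_total |ξ| 1 with h | h
    · have := Real.rpow_le_one (abs_nonneg ξ) h h0
      linarith [abs_nonneg ξ]
    · have := Real.rpow_le_rpow_of_exponent_le h h1
      rw [Real.rpow_one] at this
      linarith
  calc |ξ| ^ β * ‖g (ξ / (2 * Real.pi))‖ ≤ (1 + |ξ|) * ‖g (ξ / (2 * Real.pi))‖ := by gcongr
    _ = _ := by field_simp

lemma lintegral_fourierInt_sq (u : SchwartzMap ℝ ℂ) :
    ∫⁻ ξ, ‖fourierInt (fun y => u y) ξ‖ₑ ^ 2 =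
      ENNReal.ofReal (2 * Real.pi) * eLpNorm (fun y => u y) 2 volume ^ 2 := by
  set g := FourierTransform.fourier u with hg
  have hsq : ∀ v : SchwartzMap ℝ ℂ, Integrable fun x => ‖v x‖ ^ 2 := fun v => by
    have := (v.memLp 2 volume).integrable_norm_pow (by norm_num)
    simpa using this
  have h1 : ∫⁻ ξ, ‖fourierInt (fun y => u y) ξ‖ₑ ^ 2 =
      ENNReal.ofReal (∫ ξ, ‖g (ξ / (2 * Real.pi))‖ ^ 2) := by
    rw [ofReal_integral_eq_lintegral_ofReal ((hsq g).comp_div (by positivity))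
      (Filter.Eventually.of_forall fun ξ => by positivity)]
    refine lintegral_congr fun ξ => ?_
    rw [fourierInt_eq_fourier, ← ofReal_norm, ENNReal.ofReal_pow (norm_nonneg _)]
  have h2 : eLpNorm (fun y => u y) 2 volume ^ 2 = ENNReal.ofReal (∫ x, ‖u x‖ ^ 2) := by
    rw [eLpNorm_eq_lintegral_rpow_enorm_toReal (by norm_num) (by norm_num),
      ← ENNReal.rpow_two, ← ENNReal.rpow_mul, ofReal_integral_eq_lintegral_ofReal (hsq u)
      (Filter.Eventually.of_forall fun ξ => by positivity)]
    norm_num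
  rw [h1, h2, Measure.integral_comp_div (fun η => ‖g η‖ ^ 2), hg,
    SchwartzMap.integral_norm_sq_fourier, smul_eq_mul, ENNReal.ofReal_mul (abs_nonneg _),
    abs_of_pos (by positivity)]

lemma disp_rpow_mul_eq_osc (β : ℝ) (w : ℝ → ℂ) (t x : ℝ) :
    disp (fun ξ => ((|ξ| ^ β : ℝ) : ℂ) * w ξ) t x =
      osc (fun ξ => ((|ξ| ^ β : ℝ) : ℂ) * (cexp (I * (t * ξ ^ 4 : ℝ)) * w ξ)) x := by
  refine integral_congr_ae (Filter.Eventually.of_forall fun ξ => ?_)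
  simp only
  rw [show I * (x * ξ + t * ξ ^ 4 : ℝ) = I * (x * ξ : ℝ) + I * (t * ξ ^ 4 : ℝ) by push_cast; ring,
    Complex.exp_add]
  ring

lemma enorm_DbihamGroup_le (β t : ℝ) (u : ℝ → ℂ) (x : ℝ) :
    ‖DbihamGroup β t u x‖ₑ ≤ ‖disp (fun ξ => ((|ξ| ^ β : ℝ) : ℂ) * fourierInt u ξ) t x‖ₑ := by
  have h1 : DbihamGroup β t u x =
      (2 * Real.pi)⁻¹ * disp (fun ξ => ((|ξ| ^ β : ℝ) : ℂ) * fourierInt u ξ) t x := by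
    rw [DbihamGroup, disp]
    congr 1
    refine integral_congr_ae (Filter.Eventually.of_forall fun ξ => ?_)
    push_cast
    ring
  have h2 : ‖(((2 * Real.pi)⁻¹ : ℝ) : ℂ)‖ ≤ 1 := by
    rw [norm_real, Real.norm_of_nonneg (by positivity)]
    exact inv_le_one_of_one_le₀ (by linarith [Real.pi_gt_three])
  rw [h1, ← ofReal_norm, ← ofReal_norm, norm_mul]
  exact ENNReal.ofReal_le_ofReal (mul_le_of_le_one_left (norm_nonneg _) h2)

lemma mixedNorm_le_of_lintegral_le {q r : ℝ≥0∞} (hq0 : q ≠ 0) (hq : q ≠ ∞) {F : ℝ → ℝ → ℂ}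
    {K N : ℝ≥0∞} (h : ∫⁻ t, eLpNorm (F t) r volume ^ q.toReal ≤ K * N ^ (q.toReal / 2)) :
    mixedNorm q r F ≤ K ^ (1 / q.toReal) * N ^ (1 / 2 : ℝ) := by
  have hq' : 0 < q.toReal := ENNReal.toReal_pos hq0 hq
  rw [mixedNorm, eLpNorm_eq_lintegral_rpow_enorm_toReal hq0 hq]
  calc _ ≤ (K * N ^ (q.toReal / 2)) ^ (1 / q.toReal) := by
        refine ENNReal.rpow_le_rpow (le_trans (lintegral_mono fun t => ?_) h) (by positivity)
        refine ENNReal.rpow_le_rpow ?_ hq'.le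
        rw [Real.enorm_of_nonneg ENNReal.toReal_nonneg]
        exact ENNReal.ofReal_toReal_le
    _ = _ := by
        rw [ENNReal.mul_rpow_of_nonneg _ _ (by positivity), ← ENNReal.rpow_mul]
        congr 2
        field_simp

lemma Admissible.toReal_eq {q r : ℝ≥0∞} {α : ℝ} (h : Admissible q r α) :
    4 / q.toReal + (1 + α) / r.toReal = (1 + α) / 2 := by
  obtain ⟨⟨h0, -⟩, hr, hq, heq⟩ := h
  have hq0 : q ≠ 0 := (lt_of_lt_of_le (by simp; positivity) hq).ne'
  have hr0 : r ≠ 0 := (lt_of_lt_of_le (by simp) hr).ne'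
  have := congrArg ENNReal.toReal heq
  rwa [ENNReal.toReal_add (ENNReal.div_ne_top (by simp) hq0)
    (ENNReal.div_ne_top ENNReal.ofReal_ne_top hr0), ENNReal.toReal_div, ENNReal.toReal_div,
    ENNReal.toReal_ofReal (by positivity), ENNReal.toReal_ofReal (by positivity),
    ENNReal.toReal_ofNat] at this

lemma enorm_cexp_mul (x : ℝ) (z : ℂ) : ‖cexp (I * x) * z‖ₑ = ‖z‖ₑ := by
  rw [← ofReal_norm, norm_mul, norm_cexp_I_mul_ofReal, one_mul, ofReal_norm]

lemma exists_lintegral_iSup_disp_rpow_le {α : ℝ} (h0 : 0 ≤ α) (h1 : α ≤ 1) :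
    ∃ K : ℝ, 0 < K ∧ ∀ (f : ℝ → ℂ) (_ : Measurable f)
      (_ : Integrable fun ξ => ((|ξ| ^ (α / 2) : ℝ) : ℂ) * f ξ),
    ∫⁻ t, (⨆ x, ‖disp (fun ξ => ((|ξ| ^ (α / 2) : ℝ) : ℂ) * f ξ) t x‖ₑ) ^ (8 / (1 + α)) ≤
      (ENNReal.ofReal K * ∫⁻ ξ, ‖f ξ‖ₑ ^ 2) ^ (4 / (1 + α)) := by
  obtain ⟨K, hK0, hK⟩ := exists_lintegral_disp_rpow_le h0 h1
  exact ⟨K, hK0, fun f hf hg =>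
    lintegral_iSup_enorm_rpow_le (continuous_disp hg) (by positivity) (hK f hf hg)⟩

/-- The Strichartz estimate at finite time exponent `q`, in integrated form. -/
lemma exists_lintegral_eLpNorm_disp_le {q : ℝ} {r : ℝ≥0∞} {α : ℝ} (h0 : 0 ≤ α) (h1 : α ≤ 1)
    (hq : 0 < q) (hr : r ≠ 0) (h : 4 / q + (1 + α) / r.toReal = (1 + α) / 2) :
    ∃ K : ℝ, 0 < K ∧ ∀ (f : ℝ → ℂ) (_ : Measurable f) (_ : Integrable f)
      (_ : Integrable fun ξ => ((|ξ| ^ (α / 2) : ℝ) : ℂ) * f ξ) (_ : ∫⁻ ξ, ‖f ξ‖ₑ ^ 2 ≠ ∞),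
    ∫⁻ t, eLpNorm (disp (fun ξ => ((|ξ| ^ (α / 2 * (1 - 2 / r.toReal)) : ℝ) : ℂ) * f ξ) t)
        r volume ^ q ≤ ENNReal.ofReal K * (∫⁻ ξ, ‖f ξ‖ₑ ^ 2) ^ (q / 2) := by
  obtain ⟨K, hK0, hK⟩ := exists_lintegral_iSup_disp_rpow_le h0 h1
  rcases eq_or_ne r ∞ with rfl | hrt
  · have hq' : 8 / (1 + α) = q := by
      simp only [ENNReal.toReal_top, div_zero, add_zero] at h
      field_simp at h ⊢
      linarith
    refine ⟨K ^ (q / 2), by positivity, fun f hf _ hg _ => ?_⟩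
    have h2 := hK f hf hg
    rw [show 4 / (1 + α) = q / 2 by rw [← hq']; ring, hq',
      ENNReal.mul_rpow_of_nonneg _ _ (by positivity), ENNReal.ofReal_rpow_of_pos hK0] at h2
    refine le_trans (lintegral_mono fun t => ENNReal.rpow_le_rpow ?_ hq.le) h2
    simp only [ENNReal.toReal_top, div_zero, sub_zero, mul_one, eLpNorm_exponent_top]
    exact eLpNormEssSup_le_of_ae_enorm_bound (Filter.Eventually.of_forall fun x =>
      le_iSup (fun x => ‖disp (fun ξ => ((|ξ| ^ (α / 2) : ℝ) : ℂ) * f ξ) t x‖ₑ) x)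
  set ρ := r.toReal with hρ
  have hρ0 : 0 < ρ := ENNReal.toReal_pos hr hrt
  have hρ2 : 2 < ρ := by
    have h3 : (1 + α) / ρ < (1 + α) / 2 := by
      have : 0 < 4 / q := by positivity
      linarith
    exact (div_lt_div_iff_of_pos_left (by positivity) hρ0 (by norm_num)).mp h3
  set θ := 1 - 2 / ρ with hθ
  have h1θ : 1 - θ = 2 / ρ := by rw [hθ]; ring
  have hθ1 : θ < 1 := by have : 0 < 2 / ρ := by positivity
                         linarith
  have hθ0 : 0 < θ := by
    have : 2 / ρ < 1 := (div_lt_one hρ0).mpr hρ2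
    linarith
  have hqθ : q * θ = 8 / (1 + α) := by
    rw [hθ]
    field_simp at h ⊢
    linarith
  obtain ⟨L, hL0, hL⟩ := exists_lintegral_osc_rpow_le (a := α / 2) (by positivity) hθ0 hθ1
  refine ⟨L ^ (q / ρ) * K ^ (q * θ / 2), by positivity, fun f hf hfi hg hN => ?_⟩
  set N := ∫⁻ ξ, ‖f ξ‖ₑ ^ 2 with hNdef
  set S : ℝ → ℝ≥0∞ := fun t => ⨆ x, ‖disp (fun ξ => ((|ξ| ^ (α / 2) : ℝ) : ℂ) * f ξ) t x‖ₑ with hS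
  have hpt : ∀ t, eLpNorm (disp (fun ξ => ((|ξ| ^ (α / 2 * θ) : ℝ) : ℂ) * f ξ) t) r volume ^ q ≤
      ENNReal.ofReal L ^ (q / ρ) * N ^ (q / ρ) * S t ^ (8 / (1 + α)) := by
    intro t
    have hSt : S t ≠ ∞ := by
      refine ((iSup_le fun x => ?_).trans_lt (ENNReal.ofReal_lt_top
        (r := ∫ ξ, ‖((|ξ| ^ (α / 2) : ℝ) : ℂ) * f ξ‖))).ne
      rw [← ofReal_norm]
      exact ENNReal.ofReal_le_ofReal (norm_disp_le _ _ _)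
    have hm : Measurable fun ξ : ℝ => cexp (I * (t * ξ ^ 4 : ℝ)) * f ξ := by fun_prop
    have hi : ∀ {g : ℝ → ℂ}, Integrable g →
        Integrable fun ξ : ℝ => cexp (I * (t * ξ ^ 4 : ℝ)) * g ξ := fun hg =>
      hg.bdd_mul (c := 1) (Measurable.aestronglyMeasurable (by fun_prop))
        (Filter.Eventually.of_forall fun ξ => (norm_cexp_I_mul_ofReal _).le)
    have h4 := hL (fun ξ : ℝ => cexp (I * (t * ξ ^ 4 : ℝ)) * f ξ) hm (hi hfi)
      ((hi hg).congr (Filter.Eventually.of_forall fun ξ => by simp only; ring)) (S t) hSt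
      (fun x => by
        rw [← disp_rpow_mul_eq_osc]
        exact le_iSup (fun x => ‖disp (fun ξ => ((|ξ| ^ (α / 2) : ℝ) : ℂ) * f ξ) t x‖ₑ) x)
    simp_rw [← disp_rpow_mul_eq_osc, enorm_cexp_mul] at h4
    rw [h1θ, show 2 / (2 / ρ) = ρ by field_simp, mul_comm θ] at h4
    rw [eLpNorm_eq_lintegral_rpow_enorm_toReal hr hrt, ← ENNReal.rpow_mul, ← hρ]
    refine (ENNReal.rpow_le_rpow h4 (by positivity)).trans (le_of_eq ?_)
    rw [ENNReal.mul_rpow_of_nonneg _ _ (by positivity),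
      ENNReal.mul_rpow_of_nonneg _ _ (by positivity), ← ENNReal.rpow_mul,
      show 1 / ρ * q = q / ρ by ring,
      show 2 * θ / (2 / ρ) * (q / ρ) = 8 / (1 + α) by rw [← hqθ]; field_simp]
    ring
  refine (lintegral_mono hpt).trans ?_
  rw [lintegral_const_mul' _ _ (ENNReal.mul_ne_top
    (ENNReal.rpow_ne_top_of_nonneg (by positivity) ENNReal.ofReal_ne_top)
    (ENNReal.rpow_ne_top_of_nonneg (by positivity) hN))]
  refine (mul_le_mul_right (hK f hf hg) _).trans (le_of_eq ?_)
  rw [show 4 / (1 + α) = q * θ / 2 by rw [hqθ]; ring, ENNReal.mul_rpow_of_nonneg _ _ (by positivity),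
    ENNReal.ofReal_rpow_of_pos hL0, ENNReal.ofReal_rpow_of_pos hK0,
    ENNReal.ofReal_mul (by positivity), show q / 2 = q / ρ + q * θ / 2 by rw [hθ]; ring,
    ENNReal.rpow_add_of_nonneg _ _ (by positivity) (by positivity)]
  ring

/-- Homogeneous Strichartz estimate for the biharmonic Schrödinger group:
`‖D^{(α/2)(1-2/r)} e^{it∂_x⁴} u₀‖_{L_t^q L_x^r} ≤ C ‖u₀‖_{L²}`. -/
theorem stmt_4 (q r : ℝ≥0∞) (α : ℝ) (h : Admissible q r α) :
    ∃ C > (0:ℝ), ∀ u₀ : SchwartzMap ℝ ℂ,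
      mixedNorm q r
          (fun t x => DbihamGroup ((α/2) * (1 - 2/r.toReal)) t (fun y => u₀ y) x) ≤
        ENNReal.ofReal C * eLpNorm (fun y : ℝ => u₀ y) 2 volume := by
  have hr := h.toReal_eq
  obtain ⟨⟨h0, h1⟩, hr2, hq, -⟩ := h
  have hq0 : q ≠ 0 := (lt_of_lt_of_le (by simp; positivity) hq).ne'
  have hr0 : r ≠ 0 := (lt_of_lt_of_le (by simp) hr2).ne'
  have hint : ∀ u : SchwartzMap ℝ ℂ, Integrable (fourierInt fun y => u y) := fun u => by
    simpa using integrable_rpow_mul_fourierInt u le_rfl zero_le_one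
  rcases eq_or_ne q ∞ with rfl | hqt
  · have hr' : r.toReal = 2 := by
      simp only [ENNReal.toReal_top, div_zero, zero_add] at hr
      have : r.toReal ≠ 0 := fun h => by rw [h, div_zero] at hr; linarith
      field_simp at hr
      linarith
    have hr'' : r = 2 := by
      rw [← ENNReal.ofReal_toReal (a := r) (fun h => by simp [h] at hr'), hr', ENNReal.ofReal_ofNat]
    subst hr''
    refine ⟨2 * Real.pi, by positivity, fun u => ?_⟩
    rw [mixedNorm, eLpNorm_exponent_top]
    refine eLpNormEssSup_le_of_ae_enorm_bound (Filter.Eventually.of_forall fun t => ?_)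
    rw [Real.enorm_of_nonneg ENNReal.toReal_nonneg]
    refine ENNReal.ofReal_toReal_le.trans ?_
    rw [hr']
    norm_num only [mul_zero]
    have h3 : Integrable fun ξ : ℝ => cexp (I * (t * ξ ^ 4 : ℝ)) * fourierInt (fun y => u y) ξ :=
      (hint u).bdd_mul (c := 1) (Measurable.aestronglyMeasurable (by fun_prop))
        (Filter.Eventually.of_forall fun ξ => (norm_cexp_I_mul_ofReal _).le)
    have h4 := lintegral_osc_sq_le h3
    simp_rw [enorm_cexp_mul] at h4
    rw [lintegral_fourierInt_sq] at h4
    rw [eLpNorm_eq_lintegral_rpow_enorm_toReal (by norm_num) (by norm_num), ENNReal.toReal_ofNat]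
    calc _ ≤ ((ENNReal.ofReal (2 * Real.pi) * eLpNorm (fun y => u y) 2 volume) ^ 2) ^
          (1 / 2 : ℝ) := by
          refine ENNReal.rpow_le_rpow (le_trans ?_ (h4.trans (le_of_eq (by ring)))) (by norm_num)
          refine lintegral_mono fun x => ?_
          rw [ENNReal.rpow_two]
          gcongr
          refine (enorm_DbihamGroup_le _ _ _ _).trans (le_of_eq ?_)
          rw [disp_rpow_mul_eq_osc]
          simp
      _ = _ := by
          rw [← ENNReal.rpow_two, ← ENNReal.rpow_mul]
          norm_num
  · have hq' : 0 < q.toReal := ENNReal.toReal_pos hq0 hqt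
    obtain ⟨K, hK0, hK⟩ := exists_lintegral_eLpNorm_disp_le h0 h1 hq' hr0 hr
    refine ⟨K ^ (1 / q.toReal) * (2 * Real.pi) ^ (1 / 2 : ℝ), by positivity, fun u => ?_⟩
    have hN := lintegral_fourierInt_sq u
    have hN' : ∫⁻ ξ, ‖fourierInt (fun y => u y) ξ‖ₑ ^ 2 ≠ ∞ := by
      rw [hN]
      exact ENNReal.mul_ne_top ENNReal.ofReal_ne_top
        (ENNReal.pow_ne_top (u.memLp 2 volume).2.ne)
    have h5 := hK _ (continuous_fourierInt u).measurable (hint u)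
      (integrable_rpow_mul_fourierInt u (by positivity) (by linarith)) hN'
    refine (mixedNorm_le_of_lintegral_le hq0 hqt (le_trans (lintegral_mono fun t =>
      ENNReal.rpow_le_rpow (eLpNorm_mono_enorm fun x => enorm_DbihamGroup_le _ _ _ _) hq'.le)
      h5)).trans (le_of_eq ?_)
    rw [hN, ENNReal.mul_rpow_of_nonneg _ _ (by norm_num), ← ENNReal.rpow_two, ← ENNReal.rpow_mul,
      ENNReal.ofReal_rpow_of_pos hK0, ENNReal.ofReal_rpow_of_pos (by positivity),
      ENNReal.ofReal_mul (by positivity)]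
    norm_num
    ring
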